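/- arXiv:2507.23623 — 5 statements merged into one kernel-verified Lean document; each statement's English description precedes it below -/
import Mathlib

section
/- There exists a constant c > 0 such that, for all sufficiently large n, there exists a 3-uniform generalised hedgehog H* on n vertices whose 2-colour Ramsey number satisfies R(H*, H*) ≥ c · n^{3/2} / log n. -/
/-- A 3-uniform hypergraph: a finite vertex set together with a collection of
3-element subsets of it, called edges. -/
structure ThreeGraph (α : Type*) where
  verts : Finset α
  edges : Finset (Finset α)
  edge_card : ∀ e ∈ edges, e.card = 3
  edge_sub : ∀ e ∈ edges, e ⊆ verts

/-- `G` is a generalised hedgehog with body `B` and spike set `S`: the vertex set is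
`B ⊔ S`, every edge consists of two body vertices and one spike, and every spike lies
in exactly one edge. -/
def ThreeGraph.IsGenHedgehogWith {α : Type*} [DecidableEq α] (G : ThreeGraph α)
    (B S : Finset α) : Prop :=
  Disjoint B S ∧ G.verts = B ∪ S ∧
  (∀ e ∈ G.edges, (e ∩ B).card = 2 ∧ (e ∩ S).card = 1) ∧
  (∀ s ∈ S, (G.edges.filter (fun e => s ∈ e)).card = 1)

/-- `G` is a generalised hedgehog. -/
def ThreeGraph.IsGenHedgehog {α : Type*} [DecidableEq α] (G : ThreeGraph α) : Prop :=
  ∃ B S, G.IsGenHedgehogWith B S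

/-- The 2-colouring `c` (of the finite subsets of `β`, only the triples matter) contains
a copy of the 3-graph `G` in colour `col`. -/
def ThreeGraph.HasCopy {α β : Type*} [DecidableEq β] (G : ThreeGraph α)
    (c : Finset β → Bool) (col : Bool) : Prop :=
  ∃ f : α → β, Set.InjOn f G.verts ∧ ∀ e ∈ G.edges, c (e.image f) = col

/-- The Ramsey property for the pair of 3-graphs `(G, H)` at `N`: every red/blue colouring
of the triples of an `N`-element vertex set contains a blue (`true`) copy of `G` or a
red (`false`) copy of `H`.  The Ramsey number `R(G,H)` is the least such `N`. -/
def RamseyProp {α β : Type*} (G : ThreeGraph α) (H : ThreeGraph β) (N : ℕ) : Prop :=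
  ∀ c : Finset (Fin N) → Bool, G.HasCopy c true ∨ H.HasCopy c false

/-- Union bound: if the probabilities that a uniformly random `w : ι → κ` maps all of `E j`
into `Z j` sum to less than one, then some `w` does this for no `j`. -/
theorem exists_forall_exists_notMem {ι κ J : Type*} [Fintype ι] [DecidableEq ι] [Fintype κ]
    [DecidableEq κ] [Nonempty κ] [Fintype J] (E : J → Finset ι) (Z : J → Finset κ)
    (h : ∑ j, (((Z j).card : ℝ) / Fintype.card κ) ^ (E j).card < 1) :
    ∃ w : ι → κ, ∀ j, ∃ e ∈ E j, w e ∉ Z j := by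
  by_contra! hbad
  have hκ : (0 : ℝ) < Fintype.card κ := by exact_mod_cast Fintype.card_pos
  let A : J → Finset (ι → κ) := fun j =>
    Fintype.piFinset fun e => if e ∈ E j then Z j else Finset.univ
  have hA (j : J) : ((A j).card : ℝ) =
      (Fintype.card κ : ℝ) ^ Fintype.card ι *
        (((Z j).card : ℝ) / Fintype.card κ) ^ (E j).card := by
    have h1 : (A j).card = (Z j).card ^ (E j).card *
        Fintype.card κ ^ (Fintype.card ι - (E j).card) := by
      rw [Fintype.card_piFinset]
      simp only [apply_ite Finset.card, Finset.card_univ]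
      rw [Finset.prod_ite]
      simp [Finset.filter_not, Finset.card_sdiff]
    rw [h1, div_pow]
    have h2 := (pow_sub₀ (Fintype.card κ : ℝ) hκ.ne' (Finset.card_le_univ (E j)))
    push_cast
    rw [h2]
    field_simp
  have hcover : (Finset.univ : Finset (ι → κ)) ⊆ Finset.univ.biUnion A := by
    intro w _
    obtain ⟨j, hj⟩ := hbad w
    refine Finset.mem_biUnion.2 ⟨j, Finset.mem_univ _, Fintype.mem_piFinset.2 fun e => ?_⟩
    split_ifs with he
    · exact hj e he
    · exact Finset.mem_univ _
  have hle : (Fintype.card κ : ℝ) ^ Fintype.card ι ≤ ∑ j, ((A j).card : ℝ) := by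
    have := (Finset.card_le_card hcover).trans Finset.card_biUnion_le
    rw [Finset.card_univ, Fintype.card_fun] at this
    exact_mod_cast this
  simp_rw [hA, ← Finset.mul_sum] at hle
  have hpos : (0 : ℝ) < (Fintype.card κ : ℝ) ^ Fintype.card ι := by positivity
  nlinarith

/-- First-moment existence of a graph (from the binomial random graph with edge probability
`1 / q`) with small independence number, clique number and maximum degree. -/
theorem exists_graph_of_expectation_lt_one (N m s D q : ℕ) (hq : 1 ≤ q)
    (h : (N.choose m : ℝ) * (1 - 1 / (q : ℝ)) ^ m.choose 2 +
      ((N.choose s : ℝ) * (1 / (q : ℝ)) ^ s.choose 2 +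
        (N : ℝ) * ((N.choose D : ℝ) * (1 / (q : ℝ)) ^ D)) < 1) :
    ∃ G : SimpleGraph (Fin N),
      (∀ A : Finset (Fin N), A.card = m → ∃ x ∈ A, ∃ y ∈ A, G.Adj x y) ∧
      (∀ A : Finset (Fin N), A.card = s → ∃ x ∈ A, ∃ y ∈ A, x ≠ y ∧ ¬ G.Adj x y) ∧
      (∀ (v : Fin N) (T : Finset (Fin N)), T.card = D → ∃ y ∈ T, ¬ G.Adj v y) := by
  classical
  have : NeZero q := ⟨by omega⟩
  have hq0 : (q : ℝ) ≠ 0 := by exact_mod_cast this.ne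
  let X (k : ℕ) := {A : Finset (Fin N) // A ∈ Finset.powersetCard k Finset.univ}
  let E : X m ⊕ X s ⊕ (Fin N × X D) → Finset (Finset (Fin N)) :=
    Sum.elim (fun A => Finset.powersetCard 2 A.1)
      (Sum.elim (fun A => Finset.powersetCard 2 A.1) (fun p => p.2.1.image fun y => {p.1, y}))
  let Z : X m ⊕ X s ⊕ (Fin N × X D) → Finset (Fin q) :=
    Sum.elim (fun _ => {0}ᶜ) (Sum.elim (fun _ => {0}) (fun _ => {0}))
  have hpair (v : Fin N) : Function.Injective fun y : Fin N => ({v, y} : Finset (Fin N)) := by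
    intro y z hyz
    have hyz' : ({v, y} : Finset (Fin N)) = {v, z} := hyz
    have hy : y ∈ ({v, z} : Finset (Fin N)) := by rw [← hyz']; simp
    have hz : z ∈ ({v, y} : Finset (Fin N)) := by rw [hyz']; simp
    simp only [Finset.mem_insert, Finset.mem_singleton] at hy hz
    aesop
  have hX (k : ℕ) : Fintype.card (X k) = N.choose k := by
    simp [X]
  have hXcard {k : ℕ} (A : X k) : A.1.card = k := (Finset.mem_powersetCard.1 A.2).2
  obtain ⟨w, hw⟩ := exists_forall_exists_notMem E Z (by
    refine lt_of_eq_of_lt ?_ h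
    simp only [Fintype.sum_sum_type, E, Z, Sum.elim_inl, Sum.elim_inr, Finset.card_powersetCard,
      Finset.card_image_of_injective _ (hpair _), hXcard, Finset.sum_const, Finset.card_univ, hX,
      Fintype.card_prod, Fintype.card_fin, Finset.card_compl, Finset.card_singleton, nsmul_eq_mul]
    push_cast [Nat.cast_sub hq]
    rw [sub_div, div_self hq0]
    ring)
  refine ⟨SimpleGraph.fromRel fun x y => w {x, y} = 0, fun A hA => ?_, fun A hA => ?_,
    fun v T hT => ?_⟩
  · obtain ⟨e, he, hwe⟩ := hw (Sum.inl ⟨A, by simp [hA]⟩)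
    obtain ⟨heA, he2⟩ := Finset.mem_powersetCard.1 (show e ∈ Finset.powersetCard 2 A from he)
    obtain ⟨x, y, hxy, rfl⟩ := Finset.card_eq_two.1 he2
    refine ⟨x, heA (by simp), y, heA (by simp), ?_⟩
    simp only [Z, Sum.elim_inl, Finset.mem_compl, Finset.mem_singleton, not_not] at hwe
    simp [SimpleGraph.fromRel_adj, hxy, hwe]
  · obtain ⟨e, he, hwe⟩ := hw (Sum.inr (Sum.inl ⟨A, by simp [hA]⟩))
    obtain ⟨heA, he2⟩ := Finset.mem_powersetCard.1 (show e ∈ Finset.powersetCard 2 A from he)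
    obtain ⟨x, y, hxy, rfl⟩ := Finset.card_eq_two.1 he2
    refine ⟨x, heA (by simp), y, heA (by simp), hxy, ?_⟩
    simp only [Z, Sum.elim_inl, Sum.elim_inr, Finset.mem_singleton] at hwe
    simp [SimpleGraph.fromRel_adj, Finset.pair_comm y x, hwe]
  · obtain ⟨e, he, hwe⟩ := hw (Sum.inr (Sum.inr (v, ⟨T, by simp [hT]⟩)))
    obtain ⟨y, hy, rfl⟩ := Finset.mem_image.1
      (show e ∈ T.image fun y => ({v, y} : Finset (Fin N)) from he)
    refine ⟨y, hy, ?_⟩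
    simp only [Z, Sum.elim_inr, Finset.mem_singleton] at hwe
    simp [SimpleGraph.fromRel_adj, Finset.pair_comm y v, hwe]

/-- The generalised hedgehog with body `B`, spikes `S`, and each spike `x` attached to the
pair `φ x`. -/
def spikedHedgehog (B S : Finset ℕ) (φ : ℕ → Finset ℕ) (hBS : Disjoint B S)
    (hφ : ∀ x ∈ S, φ x ∈ Finset.powersetCard 2 B) : ThreeGraph ℕ where
  verts := B ∪ S
  edges := S.image fun x => insert x (φ x)
  edge_card := by
    intro e he
    obtain ⟨x, hx, rfl⟩ := Finset.mem_image.1 he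
    obtain ⟨h1, h2⟩ := Finset.mem_powersetCard.1 (hφ x hx)
    rw [Finset.card_insert_of_notMem fun h => Finset.disjoint_left.1 hBS (h1 h) hx, h2]
  edge_sub := by
    intro e he
    obtain ⟨x, hx, rfl⟩ := Finset.mem_image.1 he
    obtain ⟨h1, h2⟩ := Finset.mem_powersetCard.1 (hφ x hx)
    exact Finset.insert_subset (Finset.mem_union_right _ hx)
      (h1.trans Finset.subset_union_left)

theorem spikedHedgehog_isGenHedgehog (B S : Finset ℕ) (φ : ℕ → Finset ℕ) (hBS : Disjoint B S)
    (hφ : ∀ x ∈ S, φ x ∈ Finset.powersetCard 2 B) :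
    (spikedHedgehog B S φ hBS hφ).IsGenHedgehog := by
  refine ⟨B, S, hBS, rfl, fun e he => ?_, fun x hx => ?_⟩
  · obtain ⟨x, hx, rfl⟩ := Finset.mem_image.1 he
    obtain ⟨h1, h2⟩ := Finset.mem_powersetCard.1 (hφ x hx)
    have hxB : x ∉ B := fun h => Finset.disjoint_left.1 hBS h hx
    rw [Finset.insert_inter_of_notMem hxB, Finset.insert_inter_of_mem hx,
      Finset.inter_eq_left.2 h1, Finset.disjoint_iff_inter_eq_empty.1 (hBS.mono_left h1)]
    exact ⟨h2, rfl⟩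
  · refine Finset.card_eq_one.2 ⟨insert x (φ x), Finset.ext fun e => ?_⟩
    simp only [Finset.mem_filter, Finset.mem_singleton]
    constructor
    · rintro ⟨he, hxe⟩
      obtain ⟨y, hy, rfl⟩ := Finset.mem_image.1 he
      obtain ⟨h1, -⟩ := Finset.mem_powersetCard.1 (hφ y hy)
      rcases Finset.mem_insert.1 hxe with rfl | h
      · rfl
      · exact (Finset.disjoint_left.1 hBS (h1 h) hx).elim
    · rintro rfl
      exact ⟨Finset.mem_image_of_mem _ hx, Finset.mem_insert_self _ _⟩

/-- Spikes can be attached so that every pair in `P` gets a spike and every pair in `Q ⊆ P`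
gets `t` of them, as soon as there are enough spikes. -/
theorem exists_spike_assignment {γ : Type*} [DecidableEq γ] (S : Finset ℕ) (P Q : Finset γ)
    (t : ℕ) (hQP : Q ⊆ P) (hP : P.Nonempty) (hcard : P.card + Q.card * t ≤ S.card) :
    ∃ φ : ℕ → γ, (∀ x, φ x ∈ P) ∧ (∀ p ∈ P, ∃ x ∈ S, φ x = p) ∧
      ∀ p ∈ Q, t ≤ (S.filter fun x => φ x = p).card := by
  classical
  let Ω := {z // z ∈ P.disjSum (Q ×ˢ Finset.range t)}
  have hΩ : Fintype.card Ω ≤ Fintype.card S := by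
    rw [Fintype.card_coe, Fintype.card_coe, Finset.card_disjSum, Finset.card_product,
      Finset.card_range]
    exact hcard
  obtain ⟨g⟩ := Function.Embedding.nonempty_of_card_le hΩ
  obtain ⟨p₀, hp₀⟩ := hP
  have : Nonempty Ω := ⟨⟨Sum.inl p₀, by simpa using hp₀⟩⟩
  let g' : Ω → ℕ := fun z => (g z : ℕ)
  have hg' : Function.Injective g' := Subtype.val_injective.comp g.injective
  let pr : γ ⊕ (γ × ℕ) → γ := Sum.elim id Prod.fst
  have hinv (z : Ω) : Function.invFun g' (g' z) = z := Function.leftInverse_invFun hg' z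
  refine ⟨fun x => pr (Function.invFun g' x).1, fun x => ?_, fun p hp => ?_, fun p hp => ?_⟩
  · have hpr (z : Ω) : pr z.1 ∈ P := by
      obtain ⟨z | z, hz⟩ := z
      · exact Finset.inl_mem_disjSum.1 hz
      · exact hQP (Finset.mem_product.1 (Finset.inr_mem_disjSum.1 hz)).1
    exact hpr _
  · let z : Ω := ⟨Sum.inl p, by simpa using hp⟩
    refine ⟨g' z, (g z).2, ?_⟩
    simp only [hinv]
    rfl
  · let f : Fin t → ℕ := fun i => g' ⟨Sum.inr (p, i), by simp [hp]⟩
    have hf : Function.Injective f := by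
      intro i j hij
      have := hg' hij
      have h2 := congrArg Subtype.val this
      simp only [Sum.inr.injEq, Prod.mk.injEq, true_and] at h2
      exact Fin.ext h2
    calc t = (Finset.univ.image f).card := by simp [Finset.card_image_of_injective _ hf]
      _ ≤ _ := Finset.card_le_card ?_
    intro x hx
    obtain ⟨i, -, rfl⟩ := Finset.mem_image.1 hx
    refine Finset.mem_filter.2 ⟨(g _).2, ?_⟩
    simp only [f, hinv]
    rfl

/-- Colour a triple red (`false`) when it contains an edge of `G`.  If `G` has no independent
set of size `|B|`, no clique of size `|C|`, and maximum degree less than `D`, there is no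
monochromatic copy of a hedgehog all of whose body pairs carry a spike and whose pairs
inside `C` carry `2 * D` spikes. -/
theorem not_ramseyProp_spikedHedgehog {N D : ℕ} (G : SimpleGraph (Fin N))
    (B C S : Finset ℕ) (φ : ℕ → Finset ℕ) (hBS : Disjoint B S)
    (hφ : ∀ x ∈ S, φ x ∈ Finset.powersetCard 2 B) (hCB : C ⊆ B)
    (hB : ∀ p ∈ Finset.powersetCard 2 B, ∃ x ∈ S, φ x = p)
    (hC : ∀ p ∈ Finset.powersetCard 2 C, 2 * D ≤ (S.filter fun x => φ x = p).card)
    (hind : ∀ A : Finset (Fin N), A.card = B.card → ∃ x ∈ A, ∃ y ∈ A, G.Adj x y)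
    (hclq : ∀ A : Finset (Fin N), A.card = C.card → ∃ x ∈ A, ∃ y ∈ A, x ≠ y ∧ ¬ G.Adj x y)
    (hdeg : ∀ (v : Fin N) (T : Finset (Fin N)), T.card = D → ∃ y ∈ T, ¬ G.Adj v y) :
    ¬ RamseyProp (spikedHedgehog B S φ hBS hφ) (spikedHedgehog B S φ hBS hφ) N := by
  classical
  intro hR
  have hnbr (v : Fin N) : (G.neighborFinset v).card < D := by
    by_contra! h
    obtain ⟨T, hT, hTD⟩ := Finset.exists_subset_card_eq h
    obtain ⟨y, hy, hvy⟩ := hdeg v T hTD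
    exact hvy ((G.mem_neighborFinset v y).1 (hT hy))
  rcases hR fun e => decide (∀ x ∈ e, ∀ y ∈ e, ¬ G.Adj x y) with ⟨f, hf, hc⟩ | ⟨f, hf, hc⟩
  · have hfB : Set.InjOn f B := hf.mono (by simp [spikedHedgehog])
    obtain ⟨x, hx, y, hy, hxy⟩ := hind (B.image f) (Finset.card_image_of_injOn hfB)
    obtain ⟨a, ha, rfl⟩ := Finset.mem_image.1 hx
    obtain ⟨b, hb, rfl⟩ := Finset.mem_image.1 hy
    have hab : a ≠ b := by rintro rfl; exact G.irrefl hxy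
    obtain ⟨z, hz, hzp⟩ := hB {a, b} (Finset.mem_powersetCard.2
      ⟨by simp [Finset.insert_subset_iff, ha, hb], Finset.card_pair hab⟩)
    have := hc _ (Finset.mem_image_of_mem _ hz)
    simp only [hzp, decide_eq_true_eq] at this
    exact this (f a) (by simp) (f b) (by simp) hxy
  · have hfC : Set.InjOn f C := hf.mono fun x hx => by
      simp [spikedHedgehog, hCB hx]
    have hfS : Set.InjOn f S := hf.mono (by simp [spikedHedgehog])
    obtain ⟨x, hx, y, hy, hxy, hna⟩ := hclq (C.image f) (Finset.card_image_of_injOn hfC)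
    obtain ⟨a, ha, rfl⟩ := Finset.mem_image.1 hx
    obtain ⟨b, hb, rfl⟩ := Finset.mem_image.1 hy
    have hab : a ≠ b := by rintro rfl; exact hxy rfl
    have hfib := hC {a, b} (Finset.mem_powersetCard.2
      ⟨by simp [Finset.insert_subset_iff, ha, hb], Finset.card_pair hab⟩)
    have hsub : (S.filter fun x => φ x = {a, b}).image f ⊆
        G.neighborFinset (f a) ∪ G.neighborFinset (f b) := by
      intro u hu
      obtain ⟨z, hz, rfl⟩ := Finset.mem_image.1 hu
      obtain ⟨hzS, hzp⟩ := Finset.mem_filter.1 hz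
      have := hc _ (Finset.mem_image_of_mem _ hzS)
      simp only [hzp, decide_eq_false_iff_not] at this
      push Not at this
      obtain ⟨u, hu, v, hv, huv⟩ := this
      have hna' : ¬ G.Adj (f b) (f a) := fun h => hna h.symm
      simp only [Finset.image_insert, Finset.image_singleton, Finset.mem_insert,
        Finset.mem_singleton] at hu hv
      simp only [Finset.mem_union, SimpleGraph.mem_neighborFinset]
      rcases hu with rfl | rfl | rfl <;> rcases hv with rfl | rfl | rfl <;>
        first
        | exact (G.irrefl huv).elim
        | exact (hna huv).elim
        | exact (hna' huv).elim
        | exact Or.inl huv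
        | exact Or.inr huv
        | exact Or.inl huv.symm
        | exact Or.inr huv.symm
    have h1 := (Finset.card_le_card hsub).trans (Finset.card_union_le _ _)
    rw [Finset.card_image_of_injOn (hfS.mono fun x hx => (Finset.mem_filter.1 hx).1)] at h1
    have := hnbr (f a)
    have := hnbr (f b)
    omega

theorem choose_mul_pow_choose_two_le_exp {N m q : ℕ} (hN : 0 < N) (hq : 1 ≤ q) :
    (N.choose m : ℝ) * (1 - 1 / (q : ℝ)) ^ m.choose 2 ≤
      Real.exp (m * (Real.log N - (m - 1) / (2 * q))) := by
  have hN' : (0 : ℝ) < N := by exact_mod_cast hN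
  have hq' : (1 : ℝ) ≤ q := by exact_mod_cast hq
  have h0 : (0 : ℝ) ≤ 1 - 1 / q := by
    rw [sub_nonneg, div_le_one (by linarith)]
    exact hq'
  have h1 : (N.choose m : ℝ) ≤ Real.exp (m * Real.log N) := by
    rw [mul_comm, ← Real.rpow_def_of_pos hN', Real.rpow_natCast]
    exact_mod_cast Nat.choose_le_pow N m
  have h2 : (1 - 1 / (q : ℝ)) ^ m.choose 2 ≤ Real.exp (-(m * ((m - 1) / (2 * q)))) := by
    calc (1 - 1 / (q : ℝ)) ^ m.choose 2 ≤ Real.exp (-(1 / q)) ^ m.choose 2 :=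
          pow_le_pow_left₀ h0 (Real.one_sub_le_exp_neg _) _
      _ = Real.exp (-(m * ((m - 1) / (2 * q)))) := by
          rw [← Real.exp_nat_mul, Nat.cast_choose_two]
          congr 1
          field_simp
  calc _ ≤ Real.exp (m * Real.log N) * Real.exp (-(m * ((m - 1) / (2 * q)))) :=
        mul_le_mul h1 h2 (by positivity) (by positivity)
    _ = _ := by
        rw [← Real.exp_add]
        ring_nf

theorem choose_mul_inv_pow_le_exp_neg {N D q : ℕ} (hD : 0 < D) (hq : 1 ≤ q)
    (h : (N : ℝ) * Real.exp 2 ≤ D * q) :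
    (N.choose D : ℝ) * (1 / (q : ℝ)) ^ D ≤ Real.exp (-D) := by
  have hD' : (0 : ℝ) < D := by exact_mod_cast hD
  have hq' : (0 : ℝ) < q := by exact_mod_cast hq
  have h1 : (N : ℝ) / (D * q) ≤ Real.exp (-2) := by
    rw [div_le_iff₀ (by positivity), Real.exp_neg, ← div_eq_inv_mul, le_div_iff₀ (by positivity)]
    exact h
  have h2 : (D : ℝ) ^ D / D.factorial ≤ Real.exp D :=
    Real.pow_div_factorial_le_exp (x := (D : ℝ)) hD'.le D
  calc (N.choose D : ℝ) * (1 / (q : ℝ)) ^ D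
      ≤ (N : ℝ) ^ D / D.factorial * (1 / (q : ℝ)) ^ D := by
        gcongr
        exact Nat.choose_le_pow_div D N
    _ = ((N : ℝ) / (D * q)) ^ D * ((D : ℝ) ^ D / D.factorial) := by
        rw [div_pow, div_pow, mul_pow, one_pow]
        field_simp
    _ ≤ Real.exp (-2) ^ D * Real.exp D := by gcongr
    _ = Real.exp (-D) := by
        rw [← Real.exp_nat_mul, ← Real.exp_add]
        ring_nf

theorem choose_mul_inv_pow_lt_third {N q : ℕ} (hq : (2 : ℝ) ≤ q) (hN : (N : ℝ) ≤ (q : ℝ) ^ 8) :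
    (N.choose 18 : ℝ) * (1 / (q : ℝ)) ^ Nat.choose 18 2 < 1 / 3 := by
  have hq0 : (q : ℝ) ≠ 0 := by positivity
  calc (N.choose 18 : ℝ) * (1 / (q : ℝ)) ^ Nat.choose 18 2
      ≤ (N : ℝ) ^ 18 * (1 / (q : ℝ)) ^ Nat.choose 18 2 := by
        gcongr
        exact_mod_cast Nat.choose_le_pow N 18
    _ ≤ ((q : ℝ) ^ 8) ^ 18 * (1 / (q : ℝ)) ^ Nat.choose 18 2 := by gcongr
    _ = (1 / (q : ℝ)) ^ 9 := by
        rw [show Nat.choose 18 2 = 8 * 18 + 9 by decide, ← pow_mul, pow_add, ← mul_assoc,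
          ← mul_pow, mul_one_div_cancel hq0, one_pow, one_mul]
    _ ≤ (1 / 2) ^ 9 := by gcongr
    _ < 1 / 3 := by norm_num

set_option maxHeartbeats 1000000 in
/-- For `N` slightly below `n ^ (3 / 2) / log n` there is a graph on `N` vertices with
independence number below `√n`, clique number below `18` and maximum degree below
`n / 2000`. -/
theorem exists_graph_of_lt {n N : ℕ} (hn : (10 : ℝ) ^ 8 ≤ n)
    (hl1 : Real.log n ≤ 1 / 100 * (n : ℝ) ^ (1 / 4 : ℝ))
    (hl2 : Real.log n ≤ 1 / 20000 * (n : ℝ))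
    (hN : (N : ℝ) < 1 / 10 ^ 6 * (n : ℝ) ^ (3 / 2 : ℝ) / Real.log n) :
    ∃ G : SimpleGraph (Fin N),
      (∀ A : Finset (Fin N), A.card = n.sqrt → ∃ x ∈ A, ∃ y ∈ A, G.Adj x y) ∧
      (∀ A : Finset (Fin N), A.card = 18 → ∃ x ∈ A, ∃ y ∈ A, x ≠ y ∧ ¬ G.Adj x y) ∧
      (∀ (v : Fin N) (T : Finset (Fin N)), T.card = n / 2000 → ∃ y ∈ T, ¬ G.Adj v y) := by
  have hn0 : (0 : ℝ) < n := by linarith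
  set u : ℝ := (n : ℝ) ^ (1 / 4 : ℝ) with hu
  have hu0 : 0 < u := by positivity
  have hu4 : u ^ 4 = n := by
    rw [hu, ← Real.rpow_natCast, ← Real.rpow_mul hn0.le]
    norm_num
  have hu6 : (n : ℝ) ^ (3 / 2 : ℝ) = u ^ 6 := by
    rw [hu, ← Real.rpow_natCast, ← Real.rpow_mul hn0.le]
    norm_num
  have hu100 : 100 ≤ u := by
    by_contra! h
    have := pow_lt_pow_left₀ h hu0.le (n := 4) (by norm_num)
    rw [hu4] at this
    linarith
  set l := Real.log n with hl
  have hl0 : 1 ≤ l := by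
    rw [hl, Real.le_log_iff_exp_le hn0]
    linarith [Real.exp_one_lt_d9]
  have hr : 10000 ≤ u ^ 2 := by nlinarith
  rw [hu6] at hN
  have hm1 : ((n.sqrt : ℕ) : ℝ) ≤ u ^ 2 := by
    have : ((n.sqrt : ℕ) : ℝ) ^ 2 ≤ (u ^ 2) ^ 2 := by
      rw [← pow_mul, hu4]
      exact_mod_cast Nat.sqrt_le' n
    exact (pow_le_pow_iff_left₀ (by positivity) (by positivity) (by norm_num)).1 this
  have hm2 : u ^ 2 ≤ ((n.sqrt : ℕ) : ℝ) + 1 := by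
    have : (u ^ 2) ^ 2 ≤ (((n.sqrt : ℕ) : ℝ) + 1) ^ 2 := by
      rw [← pow_mul, hu4]
      exact_mod_cast (Nat.lt_succ_sqrt' n).le
    exact (pow_le_pow_iff_left₀ (by positivity) (by positivity) (by norm_num)).1 this
  generalize n.sqrt = m at hm1 hm2 ⊢
  set y := u ^ 2 / (12 * l) with hy
  have hyl : y * l = u ^ 2 / 12 := by rw [hy]; field_simp
  have hy8 : 8 * u ≤ y := by
    rw [hy, le_div_iff₀ (by positivity)]
    nlinarith
  set q := ⌊y⌋₊ with hq
  have hqy : (q : ℝ) ≤ y := Nat.floor_le (by linarith)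
  have hqy' : y / 2 ≤ q := by linarith [Nat.lt_floor_add_one y]
  have hq1 : (1 : ℝ) ≤ q := by linarith
  set D := n / 2000 with hD
  have hDn : (n : ℝ) / 4000 ≤ D := by
    have h1 : n < 2000 * D + 2000 := by omega
    have h2 : (n : ℝ) < 2000 * D + 2000 := by exact_mod_cast h1
    linarith
  have hD0 : 0 < D := by
    have : (0 : ℝ) < D := by linarith
    exact_mod_cast this
  have hq1' : 1 ≤ q := by exact_mod_cast hq1
  have hNl : (N : ℝ) * l < 1 / 10 ^ 6 * u ^ 6 := (lt_div_iff₀ (by linarith)).1 hN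
  have hN8 : (N : ℝ) ≤ u ^ 8 := by
    have h1 : (N : ℝ) ≤ N * l := le_mul_of_one_le_right (by positivity) hl0
    have h2 : u ^ 6 * 1 ≤ u ^ 6 * u ^ 2 := by gcongr; linarith
    have h3 : u ^ 6 * u ^ 2 = u ^ 8 := by ring
    have h4 : 0 < u ^ 6 := by positivity
    linarith
  have hexp : Real.exp (-2) < 1 / 3 := by
    have h2 : (3 : ℝ) < Real.exp 2 := by
      linarith [Real.add_one_lt_exp (x := (2 : ℝ)) (by norm_num)]
    rw [Real.exp_neg, inv_eq_one_div]
    exact one_div_lt_one_div_of_lt (by norm_num) h2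
  have hind : (N.choose m : ℝ) * (1 - 1 / (q : ℝ)) ^ m.choose 2 < 1 / 3 := by
    rcases Nat.eq_zero_or_pos N with rfl | hNpos
    · have : 0 < m := by
        have : (0 : ℝ) < m := by linarith
        exact_mod_cast this
      rw [Nat.choose_eq_zero_of_lt this]
      norm_num
    refine (choose_mul_pow_choose_two_le_exp hNpos hq1').trans_lt
      ((Real.exp_le_exp.2 ?_).trans_lt hexp)
    have hlogN : Real.log N ≤ 2 * l := by
      have h1 : Real.log N ≤ Real.log ((n : ℝ) ^ 2) := by
        apply Real.log_le_log (by exact_mod_cast hNpos)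
        rw [← hu4, ← pow_mul]
        exact hN8
      rwa [Real.log_pow] at h1
    have h2 : 3 * l ≤ ((m : ℝ) - 1) / (2 * q) := by
      rw [le_div_iff₀ (by positivity)]
      nlinarith [mul_le_mul_of_nonneg_right hqy (by linarith : 0 ≤ l)]
    nlinarith
  have hclq : (N.choose 18 : ℝ) * (1 / (q : ℝ)) ^ Nat.choose 18 2 < 1 / 3 := by
    have hNq : (N : ℝ) ≤ (q : ℝ) ^ 8 :=
      hN8.trans (pow_le_pow_left₀ hu0.le (by linarith) 8)
    exact choose_mul_inv_pow_lt_third (by linarith) hNq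
  have hdeg : (N : ℝ) * ((N.choose D : ℝ) * (1 / (q : ℝ)) ^ D) < 1 / 3 := by
    have hND : (N : ℝ) * Real.exp 2 ≤ D * q := by
      have h9 : Real.exp 2 ≤ 9 := by
        rw [show (2 : ℝ) = 1 + 1 by norm_num, Real.exp_add]
        nlinarith [Real.exp_one_lt_d9, Real.exp_pos 1]
      have h1 : (n : ℝ) / 4000 * (y / 2) ≤ D * q := by gcongr
      have h2 : (n : ℝ) / 4000 * (y / 2) * l = u ^ 6 / 96000 := by
        rw [← hu4]
        linear_combination (u ^ 4 / 8000) * hyl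
      have h3 : (N : ℝ) * Real.exp 2 ≤ N * 9 := by gcongr
      have h4 : (N : ℝ) * 9 * l ≤ (n : ℝ) / 4000 * (y / 2) * l := by
        have : 0 < u ^ 6 := by positivity
        rw [h2]
        linarith
      linarith [le_of_mul_le_mul_right h4 (by linarith)]
    calc (N : ℝ) * ((N.choose D : ℝ) * (1 / (q : ℝ)) ^ D)
        ≤ (n : ℝ) ^ 2 * Real.exp (-D) := by
          gcongr
          · rw [← hu4, ← pow_mul]
            exact hN8
          · exact choose_mul_inv_pow_le_exp_neg hD0 hq1' hND
      _ = Real.exp (2 * l - D) := by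
          rw [sub_eq_add_neg, Real.exp_add, hl, mul_comm 2, Real.exp_mul, Real.exp_log hn0]
          norm_num
      _ ≤ Real.exp (-2) := by
          gcongr
          linarith
      _ < 1 / 3 := hexp
  exact exists_graph_of_expectation_lt_one N m 18 D q hq1' (by linarith)

theorem eventually_log_le_mul_rpow {ε r : ℝ} (hε : 0 < ε) (hr : 0 < r) :
    ∀ᶠ n : ℕ in Filter.atTop, Real.log n ≤ ε * (n : ℝ) ^ r := by
  have h := tendsto_natCast_atTop_atTop.eventually ((isLittleO_log_rpow_atTop hr).bound hε)
  filter_upwards [h] with n hn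
  rw [Real.norm_of_nonneg (by positivity : (0 : ℝ) ≤ (n : ℝ) ^ r)] at hn
  exact (le_abs_self _).trans hn

/-- There is a constant `c > 0` such that for all sufficiently large `n` there is an
`n`-vertex generalised hedgehog `H*` with `R(H*, H*) ≥ c · n^{3/2} / log n`. -/
theorem genhedgehog_ramsey_lower_bound :
    ∃ c : ℝ, 0 < c ∧ ∃ n₀ : ℕ, ∀ n : ℕ, n₀ ≤ n →
      ∃ H : ThreeGraph ℕ, H.IsGenHedgehog ∧ H.verts.card = n ∧
        ∀ N : ℕ, RamseyProp H H N →
          c * (n : ℝ) ^ (3/2 : ℝ) / Real.log n ≤ (N : ℝ) := by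
  have hev : ∀ᶠ n : ℕ in Filter.atTop, (10 : ℝ) ^ 8 ≤ n ∧
      Real.log n ≤ 1 / 100 * (n : ℝ) ^ (1 / 4 : ℝ) ∧ Real.log n ≤ 1 / 20000 * (n : ℝ) := by
    filter_upwards [tendsto_natCast_atTop_atTop.eventually_ge_atTop ((10 : ℝ) ^ 8),
      eventually_log_le_mul_rpow (ε := 1 / 100) (r := 1 / 4) (by norm_num) (by norm_num),
      eventually_log_le_mul_rpow (ε := 1 / 20000) (r := 1) (by norm_num) (by norm_num)]
      with n h1 h2 h3
    rw [Real.rpow_one] at h3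
    exact ⟨h1, h2, h3⟩
  obtain ⟨n₀, hn₀⟩ := Filter.eventually_atTop.1 hev
  refine ⟨1 / 10 ^ 6, by norm_num, n₀, fun n hn => ?_⟩
  obtain ⟨hbig, hl1, hl2⟩ := hn₀ n hn
  have hbig' : 10 ^ 8 ≤ n := by exact_mod_cast hbig
  set m := n.sqrt with hm
  have hm18 : 18 ≤ m := Nat.le_sqrt.2 (by omega)
  have hmm : m * m ≤ n := Nat.sqrt_le n
  have hmn : m ≤ n := Nat.sqrt_le_self n
  have hBS : Disjoint (Finset.range m) (Finset.Ico m n) :=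
    Finset.disjoint_left.2 fun x hx hx' => by
      simp only [Finset.mem_range, Finset.mem_Ico] at hx hx'
      omega
  have hcard : (Finset.powersetCard 2 (Finset.range m)).card +
      (Finset.powersetCard 2 (Finset.range 18)).card * (2 * (n / 2000)) ≤
        (Finset.Ico m n).card := by
    simp only [Finset.card_powersetCard, Finset.card_range, Nat.card_Ico]
    have h1 : m.choose 2 * 2 ≤ m * m := by
      rw [Nat.choose_two_right]
      exact (Nat.div_mul_le_self _ _).trans (Nat.mul_le_mul_left _ (Nat.sub_le _ _))
    have h2 : 18 * m ≤ m * m := Nat.mul_le_mul_right _ hm18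
    rw [show Nat.choose 18 2 = 153 by decide]
    omega
  obtain ⟨φ, hφ, hP, hQ⟩ := exists_spike_assignment (Finset.Ico m n)
    (Finset.powersetCard 2 (Finset.range m)) (Finset.powersetCard 2 (Finset.range 18)) _
    (Finset.powersetCard_mono (Finset.range_subset_range.2 hm18))
    (Finset.powersetCard_nonempty.2 (by simp; omega)) hcard
  refine ⟨spikedHedgehog (Finset.range m) (Finset.Ico m n) φ hBS fun x _ => hφ x,
    spikedHedgehog_isGenHedgehog .., ?_, fun N hR => ?_⟩
  · change (Finset.range m ∪ Finset.Ico m n).card = n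
    rw [Finset.card_union_of_disjoint hBS, Finset.card_range, Nat.card_Ico]
    omega
  · by_contra! hN
    obtain ⟨G, hind, hclq, hdeg⟩ := exists_graph_of_lt hbig hl1 hl2 hN
    exact not_ramseyProp_spikedHedgehog G _ (Finset.range 18) _ φ hBS (fun x _ => hφ x)
      (Finset.range_subset_range.2 hm18) hP hQ (by simpa using hind) (by simpa using hclq)
      hdeg hR
end

section
/- There exists a constant C > 0 such that, for any sufficiently large n and any two 3-uniform generalised hedgehogs H and H' each on n vertices, the 2-colour Ramsey number satisfies R(H, H') ≤ C · n^{3/2}. -/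
/-- The number of vertices completing `u, v` to a triple of colour `col`. -/
def codegree {β : Type*} [Fintype β] [DecidableEq β] (c : Finset β → Bool) (col : Bool)
    (u v : β) : ℕ :=
  (Finset.univ.filter fun w => w ≠ u ∧ w ≠ v ∧ c {u, v, w} = col).card

theorem codegree_comm {β : Type*} [Fintype β] [DecidableEq β] (c : Finset β → Bool)
    (col : Bool) (u v : β) : codegree c col u v = codegree c col v u := by
  unfold codegree
  congr 1
  ext w
  simp only [Finset.mem_filter, Finset.mem_univ, true_and, Finset.insert_comm u v]
  tauto

/-- The vertices joined to `u` by a pair of `col`-codegree less than `n`. -/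
def lowCodegreeNeighbors {β : Type*} [Fintype β] [DecidableEq β] (c : Finset β → Bool)
    (col : Bool) (n : ℕ) (u : β) : Finset β :=
  Finset.univ.filter fun v => v ≠ u ∧ codegree c col u v < n

/-- No vertex lies in many pairs of low blue codegree and also in many of low red codegree. -/
theorem card_lowCodegreeNeighbors_le {β : Type*} [Fintype β] [DecidableEq β]
    (c : Finset β → Bool) (n : ℕ) (u : β) :
    (lowCodegreeNeighbors c true n u).card ≤ 2 * n ∨
      (lowCodegreeNeighbors c false n u).card ≤ 2 * n := by
  set P := lowCodegreeNeighbors c true n u with hP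
  set Q := lowCodegreeNeighbors c false n u with hQ
  have hblue : ∀ v ∈ P, (Q.filter fun w => w = v ∨ c {u, v, w} = true).card ≤ n := by
    intro v hv
    simp only [hP, lowCodegreeNeighbors, Finset.mem_filter, Finset.mem_univ, true_and] at hv
    have hsub : (Q.filter fun w => w = v ∨ c {u, v, w} = true) ⊆
        insert v (Finset.univ.filter fun w => w ≠ u ∧ w ≠ v ∧ c {u, v, w} = true) := by
      intro w hw
      simp only [hQ, lowCodegreeNeighbors, Finset.mem_filter, Finset.mem_univ, true_and,
        Finset.mem_insert] at hw ⊢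
      tauto
    exact (Finset.card_le_card hsub).trans ((Finset.card_insert_le _ _).trans hv.2)
  have hred : ∀ w ∈ Q, (P.filter fun v => v ≠ w ∧ c {u, v, w} = false).card ≤ n := by
    intro w hw
    simp only [hQ, lowCodegreeNeighbors, Finset.mem_filter, Finset.mem_univ, true_and] at hw
    refine (Finset.card_le_card ?_).trans hw.2.le
    intro v hv
    simp only [hP, lowCodegreeNeighbors, Finset.mem_filter, Finset.mem_univ, true_and] at hv ⊢
    rw [Finset.pair_comm w v]
    tauto
  have hsum : P.card * Q.card ≤ P.card * n + Q.card * n := by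
    have hcover : P ×ˢ Q ⊆
        (P.sigma fun v => Q.filter fun w => w = v ∨ c {u, v, w} = true).image
            (fun p => (p.1, p.2)) ∪
          (Q.sigma fun w => P.filter fun v => v ≠ w ∧ c {u, v, w} = false).image
            (fun p => (p.2, p.1)) := by
      rintro ⟨v, w⟩ h
      obtain ⟨hv, hw⟩ := Finset.mem_product.mp h
      simp only [Finset.mem_union, Finset.mem_image, Finset.mem_sigma, Finset.mem_filter]
      by_cases hc : w = v ∨ c {u, v, w} = true
      · exact Or.inl ⟨⟨v, w⟩, ⟨hv, hw, hc⟩, rfl⟩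
      · push Not at hc
        exact Or.inr ⟨⟨w, v⟩, ⟨hw, hv, hc.1.symm, by simpa using hc.2⟩, rfl⟩
    rw [← Finset.card_product]
    refine (Finset.card_le_card hcover).trans ((Finset.card_union_le _ _).trans ?_)
    gcongr
    · refine Finset.card_image_le.trans ?_
      rw [Finset.card_sigma]
      exact Finset.sum_le_card_nsmul _ _ _ hblue
    · refine Finset.card_image_le.trans ?_
      rw [Finset.card_sigma]
      exact Finset.sum_le_card_nsmul _ _ _ hred
  by_contra! h
  nlinarith [h.1, h.2]

/-- Greedy choice of distinct representatives. -/
theorem exists_injOn_mem_of_card_le {α β : Type*} [DecidableEq β] [Nonempty β] (S : Finset α)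
    (T : α → Finset β) (hT : ∀ s ∈ S, S.card ≤ (T s).card) :
    ∃ h : α → β, Set.InjOn h S ∧ ∀ s ∈ S, h s ∈ T s := by
  classical
  have hall := (Finset.all_card_le_biUnion_card_iff_exists_injective
    (fun s : S => T s)).mp ?_
  · obtain ⟨f, hf, hmem⟩ := hall
    refine ⟨fun a => if ha : a ∈ S then f ⟨a, ha⟩ else Classical.arbitrary β, ?_, ?_⟩
    · intro a ha b hb hab
      rw [Finset.mem_coe] at ha hb
      simp only [ha, hb, dif_pos] at hab
      exact congrArg Subtype.val (hf hab)
    · intro s hs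
      simpa only [hs, dif_pos] using hmem ⟨s, hs⟩
  · intro A
    rcases A.eq_empty_or_nonempty with rfl | ⟨s, hs⟩
    · simp
    · calc A.card ≤ S.card := by simpa using Finset.card_le_univ A
        _ ≤ (T s).card := hT s s.2
        _ ≤ _ := Finset.card_le_card (Finset.subset_biUnion_of_mem (fun s : S => T s) hs)

/-- Greedy embedding of a `d`-degenerate graph `adj` on `B` into `V`, avoiding pairs that are
`bad`, when every vertex of `V` lies in at most `D` bad pairs. -/
theorem exists_injOn_of_degenerate {α β : Type*} [DecidableEq α] [DecidableEq β] [Nonempty β]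
    {adj : α → α → Prop} [DecidableRel adj] (hadj : ∀ x y, adj x y → adj y x)
    (bad : β → Finset β) (hbad : ∀ u v, v ∈ bad u → u ∈ bad v) {d D : ℕ} (V : Finset β)
    (hV : ∀ u ∈ V, (bad u).card ≤ D) (B : Finset α) (hB : d * D + B.card ≤ V.card)
    (hdeg : ∀ A ⊆ B, A.Nonempty → ∃ x ∈ A, (A.filter fun y => y ≠ x ∧ adj x y).card ≤ d) :
    ∃ g : α → β, Set.InjOn g B ∧ (∀ x ∈ B, g x ∈ V) ∧
      ∀ x ∈ B, ∀ y ∈ B, x ≠ y → adj x y → g y ∉ bad (g x) := by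
  induction B using Finset.strongInduction with
  | H B ih =>
    rcases B.eq_empty_or_nonempty with rfl | hne
    · exact ⟨fun _ => Classical.arbitrary β, by simp, by simp, by simp⟩
    obtain ⟨x, hx, hxd⟩ := hdeg B subset_rfl hne
    have hcard := Finset.card_erase_add_one hx
    obtain ⟨g, hinj, hgV, hg⟩ := ih (B.erase x) (Finset.erase_ssubset hx) (by omega)
      (fun A hA => hdeg A (hA.trans (Finset.erase_subset _ _)))
    set X := (B.erase x).image g ∪
      (B.filter fun y => y ≠ x ∧ adj x y).biUnion fun y => bad (g y) with hX
    have hXcard : X.card < V.card := by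
      have h₁ : ((B.erase x).image g).card ≤ (B.erase x).card := Finset.card_image_le
      have h₂ : ((B.filter fun y => y ≠ x ∧ adj x y).biUnion fun y => bad (g y)).card ≤
          d * D := by
        refine (Finset.card_biUnion_le_card_mul _ _ D ?_).trans (Nat.mul_le_mul_right D hxd)
        intro y hy
        simp only [Finset.mem_filter] at hy
        exact hV _ (hgV y (Finset.mem_erase.mpr ⟨hy.2.1, hy.1⟩))
      have : X.card ≤ _ := Finset.card_union_le ((B.erase x).image g)
        ((B.filter fun y => y ≠ x ∧ adj x y).biUnion fun y => bad (g y))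
      omega
    obtain ⟨v, hvV, hvX⟩ := Finset.exists_mem_notMem_of_card_lt_card hXcard
    simp only [hX, Finset.mem_union, Finset.mem_image, Finset.mem_biUnion, Finset.mem_filter,
      Finset.mem_erase, not_or, not_exists, not_and] at hvX
    obtain ⟨hv₁, hv₂⟩ := hvX
    have hne_of : ∀ y ∈ B, y ≠ x → g y ≠ v := fun y hy hyx => hv₁ y ⟨hyx, hy⟩
    refine ⟨Function.update g x v, ?_, ?_, ?_⟩
    · intro a ha b hb hab
      by_cases hax : a = x <;> by_cases hbx : b = x
      · rw [hax, hbx]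
      · subst hax
        simp only [Function.update_self, Function.update_of_ne hbx] at hab
        exact absurd hab.symm (hne_of b hb hbx)
      · subst hbx
        simp only [Function.update_self, Function.update_of_ne hax] at hab
        exact absurd hab (hne_of a ha hax)
      · simp only [Function.update_of_ne hax, Function.update_of_ne hbx] at hab
        exact hinj (Finset.mem_coe.mpr (Finset.mem_erase.mpr ⟨hax, ha⟩))
          (Finset.mem_coe.mpr (Finset.mem_erase.mpr ⟨hbx, hb⟩)) hab
    · intro a ha
      by_cases hax : a = x
      · subst hax
        simpa using hvV
      · rw [Function.update_of_ne hax]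
        exact hgV a (Finset.mem_erase.mpr ⟨hax, ha⟩)
    · intro a ha b hb hab hadj'
      by_cases hax : a = x
      · subst hax
        rw [Function.update_self, Function.update_of_ne hab.symm]
        exact fun h => hv₂ b ⟨hb, hab.symm, hadj'⟩ (hbad _ _ h)
      · by_cases hbx : b = x
        · subst hbx
          rw [Function.update_self, Function.update_of_ne hab]
          exact hv₂ a ⟨ha, hab, hadj _ _ hadj'⟩
        · rw [Function.update_of_ne hax, Function.update_of_ne hbx]
          exact hg a (Finset.mem_erase.mpr ⟨hax, ha⟩) b (Finset.mem_erase.mpr ⟨hbx, hb⟩) hab hadj'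

namespace ThreeGraph.IsGenHedgehogWith

theorem card_edges_eq {α : Type*} [DecidableEq α] {G : ThreeGraph α} {B S : Finset α}
    (hG : G.IsGenHedgehogWith B S) : G.edges.card = S.card := by
  obtain ⟨-, -, hE, hS⟩ := hG
  have h := Finset.sum_card_bipartiteAbove_eq_sum_card_bipartiteBelow
    (s := G.edges) (t := S) (fun e s => s ∈ e)
  have h₁ : ∀ e ∈ G.edges, (S.bipartiteAbove (fun e s => s ∈ e) e).card = 1 := by
    intro e he
    rw [← (hE e he).2, Finset.inter_comm, ← Finset.filter_mem_eq_inter]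
    rfl
  have h₂ : ∀ s ∈ S, (G.edges.bipartiteBelow (fun e s => s ∈ e) s).card = 1 := hS
  rw [Finset.sum_congr rfl h₁, Finset.sum_congr rfl h₂] at h
  simpa using h

/-- The body graph has degeneracy at most `√(2m)`, where `m` bounds its number of edges. -/
theorem exists_card_filter_le_sqrt {α : Type*} [DecidableEq α] {G : ThreeGraph α}
    {B S : Finset α} (hG : G.IsGenHedgehogWith B S) {m : ℕ} (hm : G.edges.card ≤ m)
    {A : Finset α} (hA : A ⊆ B) (hne : A.Nonempty) :
    ∃ x ∈ A, (A.filter fun y => y ≠ x ∧ ∃ e ∈ G.edges, x ∈ e ∧ y ∈ e).card ≤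
      Nat.sqrt (2 * m) := by
  by_contra! hlt
  set d := Nat.sqrt (2 * m) with hd
  obtain ⟨-, -, hE, -⟩ := hG
  have hdA : d + 1 ≤ A.card := by
    obtain ⟨x, hx⟩ := hne
    exact (hlt x hx).trans_le (Finset.card_filter_le _ _)
  have hle : ∀ x ∈ A, d + 1 ≤ (G.edges.bipartiteAbove (fun x e => x ∈ e) x).card := by
    intro x hx
    refine (hlt x hx).trans_le (le_trans (Finset.card_le_card (t :=
      (G.edges.bipartiteAbove (fun x e => x ∈ e) x).biUnion fun e => (e ∩ B).erase x) ?_)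
      ((Finset.card_biUnion_le_card_mul _ _ 1 ?_).trans (mul_one _).le))
    · intro y hy
      simp only [Finset.mem_filter] at hy
      obtain ⟨hyA, hyx, e, he, hxe, hye⟩ := hy
      simp only [Finset.mem_biUnion, Finset.mem_bipartiteAbove, Finset.mem_erase,
        Finset.mem_inter]
      exact ⟨e, ⟨he, hxe⟩, hyx, hye, hA hyA⟩
    · intro e he
      rw [Finset.mem_bipartiteAbove] at he
      rw [Finset.card_erase_of_mem (Finset.mem_inter.mpr ⟨he.2, hA hx⟩), (hE e he.1).1]
  have hcount : A.card * (d + 1) ≤ G.edges.card * 2 := by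
    calc A.card * (d + 1) ≤ ∑ x ∈ A, (G.edges.bipartiteAbove (fun x e => x ∈ e) x).card :=
          Finset.card_nsmul_le_sum _ _ _ hle
      _ = ∑ e ∈ G.edges, (A.bipartiteBelow (fun x e => x ∈ e) e).card :=
          Finset.sum_card_bipartiteAbove_eq_sum_card_bipartiteBelow _
      _ ≤ G.edges.card * 2 := by
          refine Finset.sum_le_card_nsmul _ _ _ fun e he => ?_
          rw [← (hE e he).1]
          refine Finset.card_le_card fun x hx => ?_
          rw [Finset.mem_bipartiteBelow] at hx
          exact Finset.mem_inter.mpr ⟨hx.2, hA hx.1⟩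
  have hsq : 2 * m < (d + 1) * (d + 1) := Nat.lt_succ_sqrt _
  have := Nat.mul_le_mul_right (d + 1) hdA
  omega

end ThreeGraph.IsGenHedgehogWith

/-- A generalised hedgehog has a copy of colour `col` as soon as there is a large set of
vertices each lying in few pairs of low `col`-codegree. -/
theorem ThreeGraph.IsGenHedgehog.hasCopy {α β : Type*} [DecidableEq α] [Fintype β]
    [DecidableEq β] [Nonempty β] {G : ThreeGraph α} (hG : G.IsGenHedgehog)
    (c : Finset β → Bool) (col : Bool) {D : ℕ} (V : Finset β)
    (hV : ∀ u ∈ V, (lowCodegreeNeighbors c col G.verts.card u).card ≤ D)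
    (hcard : Nat.sqrt (2 * G.verts.card) * D + G.verts.card ≤ V.card) :
    G.HasCopy c col := by
  obtain ⟨B, S, hBS⟩ := hG
  have hEcard := hBS.card_edges_eq
  obtain ⟨hdisj, hverts, hE, hS⟩ := id hBS
  have hn : G.verts.card = B.card + S.card := by rw [hverts, Finset.card_union_of_disjoint hdisj]
  set n := G.verts.card
  obtain ⟨g, hginj, -, hg⟩ := exists_injOn_of_degenerate
    (adj := fun x y => ∃ e ∈ G.edges, x ∈ e ∧ y ∈ e)
    (fun x y ⟨e, he, hx, hy⟩ => ⟨e, he, hy, hx⟩) (lowCodegreeNeighbors c col n)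
    (fun u v h => by
      simp only [lowCodegreeNeighbors, Finset.mem_filter, Finset.mem_univ, true_and] at h ⊢
      exact ⟨h.1.symm, codegree_comm c col u v ▸ h.2⟩)
    (d := Nat.sqrt (2 * n)) V hV B (by omega)
    (fun A hA hne => hBS.exists_card_filter_le_sqrt (by omega) hA hne)
  have hT : ∀ s, ∃ T : Finset β, s ∈ S → S.card ≤ T.card ∧ Disjoint T (B.image g) ∧
      ∀ e ∈ G.edges, s ∈ e → ∀ w ∈ T, c (insert w ((e ∩ B).image g)) = col := by
    intro s
    by_cases hs : s ∈ S
    swap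
    · exact ⟨∅, fun h => absurd h hs⟩
    obtain ⟨e, he⟩ := Finset.card_eq_one.mp (hS s hs)
    have hmem : e ∈ G.edges ∧ s ∈ e := by
      have h := Finset.mem_singleton_self e
      rwa [← he, Finset.mem_filter] at h
    obtain ⟨x, y, hxy, hexy⟩ := Finset.card_eq_two.mp (hE e hmem.1).1
    have hx : x ∈ e ∩ B := by simp [hexy]
    have hy : y ∈ e ∩ B := by simp [hexy]
    rw [Finset.mem_inter] at hx hy
    have hlow := hg x hx.2 y hy.2 hxy ⟨e, hmem.1, hx.1, hy.1⟩
    have hgxy : g y ≠ g x := fun h => hxy (hginj hx.2 hy.2 h.symm)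
    simp only [lowCodegreeNeighbors, Finset.mem_filter, Finset.mem_univ, true_and, not_and,
      not_lt] at hlow
    refine ⟨(Finset.univ.filter fun w => w ≠ g x ∧ w ≠ g y ∧ c {g x, g y, w} = col) \
      B.image g, fun _ => ⟨?_, Finset.sdiff_disjoint, ?_⟩⟩
    · have h₁ := Finset.le_card_sdiff (B.image g)
        (Finset.univ.filter fun w => w ≠ g x ∧ w ≠ g y ∧ c {g x, g y, w} = col)
      have h₂ : (B.image g).card ≤ B.card := Finset.card_image_le
      have h₃ := hlow hgxy
      unfold codegree at h₃
      omega
    · intro e' he' hse' w hw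
      obtain rfl : e' = e := by
        rw [← Finset.mem_singleton, ← he]
        exact Finset.mem_filter.mpr ⟨he', hse'⟩
      simp only [Finset.mem_sdiff, Finset.mem_filter, Finset.mem_univ, true_and] at hw
      rw [hexy, ← hw.1.2.2, Finset.image_insert, Finset.image_singleton, Finset.insert_comm w,
        Finset.pair_comm w]
  choose T hT using hT
  obtain ⟨h, hhinj, hh⟩ := exists_injOn_mem_of_card_le S T fun s hs => (hT s hs).1
  have hnotB : ∀ s ∈ S, s ∉ B := fun s hs hsB => Finset.disjoint_left.mp hdisj hsB hs
  have hcross : ∀ x ∈ B, ∀ s ∈ S, g x ≠ h s := fun x hx s hs heq =>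
    Finset.disjoint_left.mp (hT s hs).2.1 (hh s hs) (heq ▸ Finset.mem_image_of_mem g hx)
  refine ⟨fun x => if x ∈ B then g x else h x, ?_, ?_⟩
  · intro a ha b hb hab
    rw [hverts, Finset.mem_coe, Finset.mem_union] at ha hb
    rcases ha with ha | ha <;> rcases hb with hb | hb
    · simp only [ha, hb, if_true] at hab
      exact hginj ha hb hab
    · simp only [ha, hnotB b hb, if_true, if_false] at hab
      exact absurd hab (hcross a ha b hb)
    · simp only [hb, hnotB a ha, if_true, if_false] at hab
      exact absurd hab.symm (hcross b hb a ha)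
    · simp only [hnotB a ha, hnotB b hb, if_false] at hab
      exact hhinj ha hb hab
  · intro e he
    obtain ⟨s, hs⟩ := Finset.card_eq_one.mp (hE e he).2
    have hse : s ∈ e ∩ S := by simp [hs]
    rw [Finset.mem_inter] at hse
    have he_eq : e = insert s (e ∩ B) := by
      rw [Finset.insert_eq, ← hs, ← Finset.inter_union_distrib_left, Finset.union_comm S,
        ← hverts, Finset.inter_eq_left.mpr (G.edge_sub e he)]
    have himage : e.image (fun x => if x ∈ B then g x else h x) =
        insert (h s) ((e ∩ B).image g) := by
      conv_lhs => rw [he_eq]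
      rw [Finset.image_insert, if_neg (hnotB s hse.2)]
      congr 1
      exact Finset.image_congr fun x hx => if_pos (Finset.mem_inter.mp hx).2
    rw [himage]
    exact (hT s hse.2).2.2 e he hse.1 _ (hh s hse.2)

/-- There is a constant `C > 0` such that for all sufficiently large `n` and any two
`n`-vertex generalised hedgehogs `H`, `H'`, we have `R(H, H') ≤ C · n^{3/2}`. -/
theorem genhedgehog_ramsey_upper_bound :
    ∃ C : ℝ, 0 < C ∧ ∃ n₀ : ℕ, ∀ n : ℕ, n₀ ≤ n →
      ∀ (α β : Type) [DecidableEq α] [DecidableEq β]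
        (H : ThreeGraph α) (H' : ThreeGraph β),
        H.IsGenHedgehog → H'.IsGenHedgehog →
        H.verts.card = n → H'.verts.card = n →
        ∃ N : ℕ, RamseyProp H H' N ∧ (N : ℝ) ≤ C * (n : ℝ) ^ (3/2 : ℝ) := by
  refine ⟨8, by norm_num, 1, fun n hn α β _ _ H H' hH hH' hHn hHn' =>
    ⟨2 * (Nat.sqrt (2 * n) * (2 * n) + n), fun c => ?_, ?_⟩⟩
  · have : Nonempty (Fin (2 * (Nat.sqrt (2 * n) * (2 * n) + n))) := ⟨⟨0, by positivity⟩⟩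
    let V (col : Bool) := Finset.univ.filter fun u =>
      (lowCodegreeNeighbors c col n u).card ≤ 2 * n
    have hcover : (Finset.univ : Finset (Fin (2 * (Nat.sqrt (2 * n) * (2 * n) + n)))) ⊆
        V true ∪ V false := fun u _ => by
      simpa [V] using card_lowCodegreeNeighbors_le c n u
    have hcard := (Finset.card_le_card hcover).trans (Finset.card_union_le _ _)
    rw [Finset.card_univ, Fintype.card_fin] at hcard
    have hVmem : ∀ col, ∀ u ∈ V col, (lowCodegreeNeighbors c col n u).card ≤ 2 * n :=
      fun col u hu => (Finset.mem_filter.mp hu).2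
    by_cases hlarge : Nat.sqrt (2 * n) * (2 * n) + n ≤ (V true).card
    · left
      subst hHn
      exact hH.hasCopy c true (V true) (hVmem true) hlarge
    · right
      subst hHn'
      exact hH'.hasCopy c false (V false) (hVmem false) (by omega)
  · have hn1 : (1 : ℝ) ≤ n := by exact_mod_cast hn
    have hpow : (n : ℝ) ^ (3 / 2 : ℝ) = n * Real.sqrt n := by
      rw [Real.sqrt_eq_rpow, show (3 / 2 : ℝ) = 1 + 1 / 2 by norm_num,
        Real.rpow_add (by positivity), Real.rpow_one]
    have hsqrt : (Nat.sqrt (2 * n) : ℝ) ≤ 3 / 2 * Real.sqrt n := by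
      refine Real.nat_sqrt_le_real_sqrt.trans (Real.sqrt_le_iff.mpr ⟨by positivity, ?_⟩)
      rw [mul_pow, Real.sq_sqrt (by positivity)]
      push_cast
      linarith
    have hone : 1 ≤ Real.sqrt n := Real.one_le_sqrt.mpr hn1
    rw [hpow]
    push_cast
    nlinarith [mul_le_mul_of_nonneg_right hsqrt (by positivity : (0 : ℝ) ≤ n),
      mul_le_mul_of_nonneg_right hone (by positivity : (0 : ℝ) ≤ n)]
end

section
/- There exists a constant c > 0 such that, for all sufficiently large n, there exists a 3-uniform generalised hedgehog H* on n vertices with R(S_n, H*) ≥ c · n^{3/2} / log n, where S_n denotes the standard hedgehog on n vertices, i.e., the 3-graph whose body has t vertices and which has exactly one spike attached to each of the binom(t,2) pairs of body vertices, t being the largest integer with t + binom(t,2) ≤ n. -/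
/-- `G` is a standard hedgehog with body `B` and spike set `S`: it is a generalised
hedgehog with body `B` and spikes `S`, and moreover every pair of distinct body
vertices forms an edge with exactly one spike. -/
def ThreeGraph.IsStandardHedgehogWith {α : Type*} [DecidableEq α] (G : ThreeGraph α)
    (B S : Finset α) : Prop :=
  G.IsGenHedgehogWith B S ∧
  ∀ u ∈ B, ∀ v ∈ B, u ≠ v →
    (G.edges.filter (fun e => u ∈ e ∧ v ∈ e)).card = 1

theorem card_filter_forall_mem {ι κ : Type*} [Fintype ι] [DecidableEq ι] [Fintype κ] [Nonempty κ]
    [DecidableEq κ] (E : Finset ι) (A : Finset κ) :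
    ((Finset.univ.filter fun ω : ι → κ => ∀ e ∈ E, ω e ∈ A).card : ℝ) =
      (Fintype.card (ι → κ) : ℝ) * ((A.card : ℝ) / Fintype.card κ) ^ E.card := by
  have h : (Finset.univ.filter fun ω : ι → κ => ∀ e ∈ E, ω e ∈ A) =
      Fintype.piFinset (fun e => if e ∈ E then A else Finset.univ) := by
    ext ω
    simp only [Finset.mem_filter, Finset.mem_univ, true_and, Fintype.mem_piFinset]
    refine forall_congr' fun e => ?_
    split_ifs with he <;> simp [he]
  have hκ : (Fintype.card κ : ℝ) ≠ 0 := by exact_mod_cast Fintype.card_ne_zero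
  have hE : (Fintype.card ι : ℕ) = E.card + Eᶜ.card := (Finset.card_add_card_compl E).symm
  have hcard : ∀ e, (if e ∈ E then A else (Finset.univ : Finset κ)).card =
      if e ∈ E then A.card else Fintype.card κ := by
    intro e; split_ifs <;> simp
  rw [h, Fintype.card_piFinset]
  simp only [hcard]
  rw [Finset.prod_ite, Finset.prod_const, Finset.prod_const, Fintype.card_fun, hE]
  have h1 : (Finset.univ.filter fun x => x ∈ E) = E := by ext; simp
  have h2 : (Finset.univ.filter fun x => x ∉ E) = Eᶜ := by ext; simp
  rw [h1, h2]
  push_cast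
  rw [pow_add, div_pow]
  field_simp

/-- Union bound for random functions. -/
theorem card_exists_forall_mem_le {ι κ α : Type*} [Fintype ι] [DecidableEq ι] [Fintype κ]
    [Nonempty κ] [DecidableEq κ] (I : Finset α) (E : α → Finset ι) (A : Finset κ) (m : ℕ)
    (hE : ∀ a ∈ I, (E a).card = m) :
    ((Finset.univ.filter fun ω : ι → κ => ∃ a ∈ I, ∀ e ∈ E a, ω e ∈ A).card : ℝ) ≤
      (Fintype.card (ι → κ) : ℝ) * (I.card * ((A.card : ℝ) / Fintype.card κ) ^ m) := by
  have h : (Finset.univ.filter fun ω : ι → κ => ∃ a ∈ I, ∀ e ∈ E a, ω e ∈ A) =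
      I.biUnion fun a => Finset.univ.filter fun ω : ι → κ => ∀ e ∈ E a, ω e ∈ A := by
    ext ω; simp
  rw [h]
  calc _ ≤ ((∑ a ∈ I, (Finset.univ.filter fun ω : ι → κ => ∀ e ∈ E a, ω e ∈ A).card : ℕ) : ℝ) :=
        by exact_mod_cast Finset.card_biUnion_le
    _ = ∑ a ∈ I, (Fintype.card (ι → κ) : ℝ) * ((A.card : ℝ) / Fintype.card κ) ^ m := by
        push_cast
        exact Finset.sum_congr rfl fun a ha => by rw [card_filter_forall_mem, hE a ha]
    _ = _ := by rw [Finset.sum_const, nsmul_eq_mul]; ring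

/-- Union bound for the random graph with edge probability `1 / q`: a graph without independent
sets of size `s`, without `b`-cliques and with all degrees less than `D`. -/
theorem exists_graph_of_union_bound (N q s b D : ℕ) (hq : 0 < q)
    (h : (N : ℝ) ^ s * (1 - 1 / q) ^ s.choose 2 + (N : ℝ) ^ b * (1 / q) ^ b.choose 2 +
      N * ((N.choose D : ℝ) * (1 / q) ^ D) < 1) :
    ∃ G : SimpleGraph (Fin N),
      (∀ I : Finset (Fin N), I.card = s → ∃ x ∈ I, ∃ y ∈ I, G.Adj x y) ∧
      (∀ I : Finset (Fin N), I.card = b → ∃ x ∈ I, ∃ y ∈ I, x ≠ y ∧ ¬ G.Adj x y) ∧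
      (∀ (x : Fin N) (T : Finset (Fin N)), (∀ y ∈ T, G.Adj x y) → T.card < D) := by
  classical
  have : NeZero q := ⟨hq.ne'⟩
  let P : Finset (Fin N) → Finset (Sym2 (Fin N)) := fun I => I.offDiag.image Sym2.mk.uncurry
  have hP : ∀ I, (P I).card = I.card.choose 2 := fun I => Sym2.card_image_offDiag I
  let Ω := Sym2 (Fin N) → Fin q
  have e1 := card_exists_forall_mem_le (κ := Fin q) (Finset.univ.powersetCard s) P {0}ᶜ (s.choose 2)
    (fun a ha => by rw [hP, (Finset.mem_powersetCard.1 ha).2])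
  have e2 := card_exists_forall_mem_le (κ := Fin q) (Finset.univ.powersetCard b) P {0} (b.choose 2)
    (fun a ha => by rw [hP, (Finset.mem_powersetCard.1 ha).2])
  have e3 := card_exists_forall_mem_le (κ := Fin q)
    ((Finset.univ : Finset (Fin N)) ×ˢ Finset.univ.powersetCard D)
    (fun a => a.2.image fun y => s(a.1, y)) {0} D
    (fun a ha => by
      rw [Finset.card_image_of_injective _ (fun y z hyz => Sym2.congr_right.1 hyz)]
      exact (Finset.mem_powersetCard.1 (Finset.mem_product.1 ha).2).2)
  let B1 := Finset.univ.filter fun ω : Ω => ∃ a ∈ Finset.univ.powersetCard s,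
    ∀ e ∈ P a, ω e ∈ ({0}ᶜ : Finset (Fin q))
  let B2 := Finset.univ.filter fun ω : Ω => ∃ a ∈ Finset.univ.powersetCard b,
    ∀ e ∈ P a, ω e ∈ ({0} : Finset (Fin q))
  let B3 := Finset.univ.filter fun ω : Ω =>
    ∃ a ∈ (Finset.univ : Finset (Fin N)) ×ˢ Finset.univ.powersetCard D,
    ∀ e ∈ a.2.image fun y => s(a.1, y), ω e ∈ ({0} : Finset (Fin q))
  have hqR : (1 : ℝ) ≤ q := by exact_mod_cast hq
  have hT : (0 : ℝ) < Fintype.card Ω := by exact_mod_cast Fintype.card_pos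
  have hlt : (B1 ∪ B2 ∪ B3).card < Fintype.card Ω := by
    have hc : ((B1 ∪ B2 ∪ B3).card : ℝ) ≤ B1.card + B2.card + B3.card := by
      exact_mod_cast (Finset.card_union_le _ _).trans
        (Nat.add_le_add_right (Finset.card_union_le _ _) _)
    have hch : ∀ k, (N.choose k : ℝ) ≤ (N : ℝ) ^ k := fun k => by
      exact_mod_cast Nat.choose_le_pow N k
    have hq1 : (((({0}ᶜ : Finset (Fin q)).card : ℕ) : ℝ) / Fintype.card (Fin q)) = 1 - 1 / q := by
      rw [Finset.card_compl]
      simp only [Fintype.card_fin, Finset.card_singleton]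
      rw [Nat.cast_sub hq]
      field_simp
      simp
    have hnn : (0 : ℝ) ≤ 1 - 1 / q := by
      rw [sub_nonneg, div_le_one (by linarith)]; exact hqR
    rw [hq1] at e1
    simp only [Finset.card_powersetCard, Finset.card_univ, Fintype.card_fin,
      Finset.card_singleton, Finset.card_product, Nat.cast_one, Nat.cast_mul] at e1 e2 e3
    have f1 : (N.choose s : ℝ) * (1 - 1 / q) ^ s.choose 2 ≤ N ^ s * (1 - 1 / q) ^ s.choose 2 :=
      mul_le_mul_of_nonneg_right (hch s) (by positivity)
    have f2 : (N.choose b : ℝ) * (1 / q) ^ b.choose 2 ≤ N ^ b * (1 / q) ^ b.choose 2 :=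
      mul_le_mul_of_nonneg_right (hch b) (by positivity)
    have : ((B1 ∪ B2 ∪ B3).card : ℝ) < Fintype.card Ω := by
      have g1 := mul_le_mul_of_nonneg_left f1 hT.le
      have g2 := mul_le_mul_of_nonneg_left f2 hT.le
      have g3 := mul_lt_mul_of_pos_left h hT
      simp only [mul_add, mul_one] at g3
      have e1' : (B1.card : ℝ) ≤ Fintype.card Ω * (N.choose s * (1 - 1 / q) ^ s.choose 2) := by
        convert e1
      have e2' : (B2.card : ℝ) ≤ Fintype.card Ω * (N.choose b * (1 / q) ^ b.choose 2) := by
        convert e2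
      have e3' : (B3.card : ℝ) ≤ Fintype.card Ω * (N * (N.choose D * (1 / q) ^ D)) := by
        rw [← mul_assoc (N : ℝ)]
        convert e3
      linarith
    exact_mod_cast this
  obtain ⟨ω, hω⟩ : ∃ ω, ω ∉ B1 ∪ B2 ∪ B3 := by
    by_contra! hall
    rw [Finset.eq_univ_iff_forall.2 hall, Finset.card_univ] at hlt
    exact lt_irrefl _ hlt
  simp only [Finset.mem_union, not_or, B1, B2, B3, Finset.mem_filter, Finset.mem_univ, true_and,
    not_exists, not_and] at hω
  obtain ⟨⟨h1, h2⟩, h3⟩ := hω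
  let G : SimpleGraph (Fin N) :=
    { Adj := fun x y => x ≠ y ∧ ω s(x, y) = 0
      symm := ⟨fun x y hxy => ⟨hxy.1.symm, by rw [Sym2.eq_swap]; exact hxy.2⟩⟩
      loopless := ⟨fun x hx => hx.1 rfl⟩ }
  refine ⟨G, fun I hI => ?_, fun I hI => ?_, fun x T hT => ?_⟩
  · by_contra! hcon
    refine h1 I (by simp [hI]) fun e he => ?_
    obtain ⟨⟨x, y⟩, hxy, rfl⟩ := Finset.mem_image.1 he
    rw [Finset.mem_offDiag] at hxy
    have := hcon x hxy.1 y hxy.2.1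
    simpa [G, hxy.2.2] using this
  · by_contra! hcon
    refine h2 I (by simp [hI]) fun e he => ?_
    obtain ⟨⟨x, y⟩, hxy, rfl⟩ := Finset.mem_image.1 he
    rw [Finset.mem_offDiag] at hxy
    simpa using (hcon x hxy.1 y hxy.2.1 hxy.2.2).2
  · by_contra! hcon
    obtain ⟨U, hU, hUc⟩ := Finset.exists_subset_card_eq hcon
    refine h3 (x, U) (by simp [hUc]) fun e he => ?_
    obtain ⟨y, hy, rfl⟩ := Finset.mem_image.1 he
    simpa using (hT y (hU hy)).2

open Filter Real in
theorem eventually_growth :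
    ∀ᶠ s : ℕ in atTop, 1 ≤ Real.log s ∧ 578 * Real.log s ^ 2 ≤ s ∧ (1000000 : ℝ) ≤ s ∧
      (s : ℝ) ^ 3 * (1 / 2) ^ s ≤ 1 / 4 := by
  have h1 : ∀ᶠ s : ℕ in atTop, 1 ≤ Real.log s :=
    (tendsto_log_atTop.comp tendsto_natCast_atTop_atTop).eventually_ge_atTop 1
  have h2 : ∀ᶠ s : ℕ in atTop, 578 * Real.log s ^ 2 ≤ s := by
    have := (isLittleO_pow_log_id_atTop (n := 2)).comp_tendsto
      (tendsto_natCast_atTop_atTop (R := ℝ))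
    have := this.bound (c := 1 / 578) (by norm_num)
    filter_upwards [this] with s hs
    simp only [Function.comp, id, norm_pow, Real.norm_eq_abs, sq_abs, Nat.abs_cast] at hs
    linarith
  have h3 : ∀ᶠ s : ℕ in atTop, (1000000 : ℝ) ≤ s :=
    tendsto_natCast_atTop_atTop.eventually_ge_atTop _
  have h4 : ∀ᶠ s : ℕ in atTop, (s : ℝ) ^ 3 * (1 / 2) ^ s ≤ 1 / 4 :=
    (tendsto_pow_const_mul_const_pow_of_lt_one 3 (by norm_num : (0 : ℝ) ≤ 1 / 2)
      (by norm_num)).eventually_le_const (by norm_num)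
  filter_upwards [h1, h2, h3, h4] with s a b c d using ⟨a, b, c, d⟩

theorem choose_mul_pow_le {N D : ℕ} {p : ℝ} (hp : 0 ≤ p) (hD : 6 * (N * p) ≤ D) :
    (N.choose D : ℝ) * p ^ D ≤ (1 / 2) ^ D := by
  rcases Nat.eq_zero_or_pos D with rfl | hD0
  · simp
  have hDR : (0 : ℝ) < D := by exact_mod_cast hD0
  have hf : (0 : ℝ) < D.factorial := by exact_mod_cast D.factorial_pos
  have h1 : (N.choose D : ℝ) ≤ N ^ D / D.factorial := Nat.choose_le_pow_div D N
  have h2 : (D : ℝ) ^ D / D.factorial ≤ 3 ^ D :=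
    calc (D : ℝ) ^ D / D.factorial ≤ Real.exp D := Real.pow_div_factorial_le_exp _ hDR.le D
      _ = Real.exp 1 ^ D := by rw [← Real.exp_nat_mul, mul_one]
      _ ≤ 3 ^ D := pow_le_pow_left₀ (Real.exp_pos _).le Real.exp_one_lt_three.le _
  have h3 : (N * p) ^ D ≤ (D / 6 : ℝ) ^ D :=
    pow_le_pow_left₀ (by positivity) (by linarith) _
  calc (N.choose D : ℝ) * p ^ D ≤ N ^ D / D.factorial * p ^ D := by gcongr
    _ = (N * p) ^ D / D.factorial := by rw [mul_pow]; ring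
    _ ≤ (D / 6 : ℝ) ^ D / D.factorial := by gcongr
    _ = (D : ℝ) ^ D / D.factorial * (1 / 6) ^ D := by rw [div_pow, div_pow]; ring
    _ ≤ 3 ^ D * (1 / 6) ^ D := by gcongr
    _ = (1 / 2) ^ D := by rw [← mul_pow]; norm_num

/-- The numerical condition of the union bound, for cliques on 13 vertices. -/
theorem union_bound_lt_one {s N : ℕ} (hL : 1 ≤ Real.log s) (hs : 578 * Real.log s ^ 2 ≤ s)
    (hs' : (1000000 : ℝ) ≤ s) (hpow : (s : ℝ) ^ 3 * (1 / 2) ^ s ≤ 1 / 4)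
    (hN : (N : ℝ) ≤ s ^ 3 / (50000 * Real.log s)) :
    ∃ q : ℕ, 0 < q ∧
      (N : ℝ) ^ s * (1 - 1 / q) ^ s.choose 2 + (N : ℝ) ^ 13 * (1 / q) ^ (13).choose 2 +
        N * ((N.choose (s ^ 2 / 400) : ℝ) * (1 / q) ^ (s ^ 2 / 400)) < 1 := by
  set L := Real.log s
  have hs0 : (0 : ℝ) < s := by linarith
  have hL0 : 0 < L := by linarith
  have hLs : 272 * L ≤ s := by nlinarith
  have hNs : (N : ℝ) ≤ s ^ 3 := hN.trans (div_le_self (by positivity) (by linarith))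
  set q := ⌊(s : ℝ) / (16 * L)⌋₊
  have hq1 : (q : ℝ) ≤ s / (16 * L) := Nat.floor_le (by positivity)
  have hq2 : (s : ℝ) / (17 * L) ≤ q := by
    have h := Nat.lt_floor_add_one ((s : ℝ) / (16 * L))
    have h' : (s : ℝ) / (16 * L) = s / (17 * L) + s / (272 * L) := by field_simp; norm_num
    have h'' : 1 ≤ (s : ℝ) / (272 * L) := by rw [le_div_iff₀ (by positivity)]; linarith
    change _ < (q : ℝ) + 1 at h
    linarith
  have hq0 : (0 : ℝ) < q := lt_of_lt_of_le (by positivity) hq2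
  have hqN : 0 < q := by exact_mod_cast hq0
  have hqge : (1 : ℝ) ≤ q := by exact_mod_cast hqN
  refine ⟨q, hqN, ?_⟩
  have b1 : (N : ℝ) ^ s * (1 - 1 / q) ^ s.choose 2 ≤ 1 / 3 := by
    have hexp : (s : ℝ) = Real.exp L := (Real.exp_log hs0).symm
    have c1 : (N : ℝ) ^ s ≤ Real.exp (s * (3 * L)) := by
      rw [Real.exp_nat_mul]
      refine pow_le_pow_left₀ (by positivity) (hNs.trans ?_) _
      rw [show (3 : ℝ) * L = ((3 : ℕ) : ℝ) * L by norm_num, Real.exp_nat_mul, ← hexp]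
    have hnn : (0 : ℝ) ≤ 1 - 1 / q := by
      rw [sub_nonneg, div_le_one hq0]; exact hqge
    have c2 : (1 - 1 / (q : ℝ)) ^ s.choose 2 ≤ Real.exp (-(8 * L * (s - 1))) := by
      calc (1 - 1 / (q : ℝ)) ^ s.choose 2 ≤ Real.exp (-(1 / q)) ^ s.choose 2 :=
            pow_le_pow_left₀ hnn (Real.one_sub_le_exp_neg _) _
        _ = Real.exp (s.choose 2 * -(1 / q)) := (Real.exp_nat_mul _ _).symm
        _ ≤ _ := by
          rw [Real.exp_le_exp, Nat.cast_choose_two]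
          have : 16 * L / s ≤ 1 / q := by
            rw [le_div_iff₀ hq0, div_mul_eq_mul_div, div_le_one hs0]
            rw [le_div_iff₀ (by positivity)] at hq1
            linarith
          have h5 := mul_le_mul_of_nonneg_left this
            (show (0 : ℝ) ≤ s * (s - 1) / 2 by
              have : (0 : ℝ) ≤ s - 1 := by linarith
              positivity)
          have h6 : (s : ℝ) * (s - 1) / 2 * (16 * L / s) = 8 * L * (s - 1) := by
            field_simp; ring
          linarith
    calc _ ≤ Real.exp (s * (3 * L)) * Real.exp (-(8 * L * (s - 1))) := by gcongr
      _ = Real.exp (s * (3 * L) + -(8 * L * (s - 1))) := (Real.exp_add _ _).symm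
      _ ≤ Real.exp (-2) := by
          rw [Real.exp_le_exp]
          nlinarith
      _ ≤ 1 / 3 := by
          rw [Real.exp_neg, inv_eq_one_div]
          have := Real.add_one_le_exp (2 : ℝ)
          exact one_div_le_one_div_of_le (by norm_num) (by linarith)
  have b2 : (N : ℝ) ^ 13 * (1 / q) ^ (13).choose 2 ≤ 1 / 3 := by
    have c1 : 2 * (s : ℝ) ≤ q ^ 2 := by
      calc 2 * (s : ℝ) ≤ (s / (17 * L)) ^ 2 := by
            rw [div_pow, le_div_iff₀ (by positivity)]
            nlinarith
        _ ≤ q ^ 2 := by gcongr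
    have hch : (13).choose 2 = 78 := by decide
    rw [hch]
    calc (N : ℝ) ^ 13 * (1 / (q : ℝ)) ^ 78 ≤ ((s : ℝ) ^ 3) ^ 13 * (1 / (q : ℝ)) ^ 78 := by gcongr
      _ = ((s : ℝ) / (q : ℝ) ^ 2) ^ 39 := by
          rw [div_pow, div_pow, ← pow_mul, ← pow_mul]; norm_num [div_eq_mul_inv]
      _ ≤ (1 / 2) ^ 39 := by
          refine pow_le_pow_left₀ (by positivity) ?_ _
          rw [div_le_iff₀ (by positivity)]
          linarith
      _ ≤ 1 / 3 := by norm_num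
  have b3 : (N : ℝ) * ((N.choose (s ^ 2 / 400) : ℝ) * (1 / q) ^ (s ^ 2 / 400)) ≤ 1 / 4 := by
    set D := s ^ 2 / 400
    have hD : (s : ℝ) ^ 2 / 400 - 1 ≤ D := by
      have h := Nat.lt_div_mul_add (a := s ^ 2) (b := 400) (by norm_num)
      have h' : (s : ℝ) ^ 2 < D * 400 + 400 := by exact_mod_cast h
      linarith
    have hsD : s ≤ D := by
      have : (s : ℝ) ≤ D := by nlinarith
      exact_mod_cast this
    have hNq : 6 * ((N : ℝ) * (1 / q)) ≤ D := by
      have h1 : (N : ℝ) * (1 / q) ≤ s ^ 3 / (50000 * L) * (17 * L / s) := by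
        have : 1 / (q : ℝ) ≤ 17 * L / s := by
          rw [div_le_div_iff₀ hq0 hs0]
          rw [div_le_iff₀ (by positivity)] at hq2
          linarith
        gcongr
      have h2 : (s : ℝ) ^ 3 / (50000 * L) * (17 * L / s) = 17 / 50000 * s ^ 2 := by
        field_simp
      rw [h2] at h1
      nlinarith
    calc _ ≤ (s : ℝ) ^ 3 * (1 / 2) ^ D := by
          gcongr
          exact choose_mul_pow_le (by positivity) hNq
      _ ≤ (s : ℝ) ^ 3 * (1 / 2) ^ s := by
          gcongr ?_ * ?_
          exact pow_le_pow_of_le_one (by norm_num) (by norm_num) hsD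
      _ ≤ 1 / 4 := hpow
  linarith

/-- The generalised hedgehog with body `{0, …, k - 1}` and spikes `{k, …, n - 1}` in which the
spike `v` is attached to the pair `{a v, b v}`. -/
def hedgehogOfPairs (k n : ℕ) (a b : ℕ → ℕ) (ha : ∀ v, a v < k) (hb : ∀ v, b v < k)
    (hab : ∀ v, a v ≠ b v) : ThreeGraph ℕ where
  verts := Finset.range k ∪ Finset.Ico k n
  edges := (Finset.Ico k n).image fun v => {a v, b v, v}
  edge_card := by
    intro e he
    obtain ⟨v, hv, rfl⟩ := Finset.mem_image.1 he
    have := ha v; have := hb v; have := hab v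
    rw [Finset.mem_Ico] at hv
    exact Finset.card_eq_three.2 ⟨_, _, _, hab v, by omega, by omega, rfl⟩
  edge_sub := by
    intro e he
    obtain ⟨v, hv, rfl⟩ := Finset.mem_image.1 he
    intro x hx
    have := ha v; have := hb v
    simp only [Finset.mem_insert, Finset.mem_singleton, Finset.mem_union, Finset.mem_range,
      Finset.mem_Ico] at *
    omega

theorem hedgehogOfPairs_isGenHedgehog (k n : ℕ) (a b : ℕ → ℕ) (ha : ∀ v, a v < k)
    (hb : ∀ v, b v < k) (hab : ∀ v, a v ≠ b v) :
    (hedgehogOfPairs k n a b ha hb hab).IsGenHedgehog := by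
  refine ⟨Finset.range k, Finset.Ico k n, ?_, rfl, ?_, ?_⟩
  · rw [Finset.disjoint_left]
    intro x hx hx'
    simp only [Finset.mem_range, Finset.mem_Ico] at hx hx'
    omega
  · intro e he
    obtain ⟨v, hv, rfl⟩ := Finset.mem_image.1 he
    have h1 := ha v; have h2 := hb v
    have hv' := Finset.mem_Ico.1 hv
    have e1 : ({a v, b v, v} : Finset ℕ) ∩ Finset.range k = {a v, b v} := by
      ext x
      simp only [Finset.mem_inter, Finset.mem_insert, Finset.mem_singleton, Finset.mem_range]
      omega
    have e2 : ({a v, b v, v} : Finset ℕ) ∩ Finset.Ico k n = {v} := by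
      ext x
      simp only [Finset.mem_inter, Finset.mem_insert, Finset.mem_singleton, Finset.mem_Ico]
      omega
    exact ⟨by rw [e1, Finset.card_pair (hab v)], by rw [e2, Finset.card_singleton]⟩
  · intro s hs
    rw [Finset.card_eq_one]
    refine ⟨{a s, b s, s}, ?_⟩
    ext e
    simp only [hedgehogOfPairs, Finset.mem_filter, Finset.mem_image, Finset.mem_singleton]
    constructor
    · rintro ⟨⟨v, hv, rfl⟩, hse⟩
      have h1 := ha v; have h2 := hb v
      simp only [Finset.mem_insert, Finset.mem_singleton, Finset.mem_Ico] at hse hs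
      obtain rfl : s = v := by omega
      rfl
    · rintro rfl
      exact ⟨⟨s, hs, rfl⟩, by simp⟩

/-- If every pair of body vertices carries `2 * D` spikes, then no copy of the hedgehog consists of
triples spanning an edge of `F`, for a graph `F` without `k`-cliques and of maximum degree less
than `D`. -/
theorem hedgehogOfPairs_not_hasCopy {V : Type*} [DecidableEq V] (k n D : ℕ) (a b : ℕ → ℕ)
    (ha : ∀ v, a v < k) (hb : ∀ v, b v < k) (hab : ∀ v, a v ≠ b v)
    (hspikes : ∀ i < k, ∀ j < k, i ≠ j → ∃ T ⊆ Finset.Ico k n, T.card = 2 * D ∧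
      ∀ v ∈ T, a v = i ∧ b v = j)
    (F : SimpleGraph V) (c : Finset V → Bool)
    (hc : ∀ e, c e = false → ∃ x ∈ e, ∃ y ∈ e, F.Adj x y)
    (hclique : ∀ I : Finset V, I.card = k → ∃ x ∈ I, ∃ y ∈ I, x ≠ y ∧ ¬ F.Adj x y)
    (hdeg : ∀ (x : V) (T : Finset V), (∀ y ∈ T, F.Adj x y) → T.card < D) :
    ¬ (hedgehogOfPairs k n a b ha hb hab).HasCopy c false := by
  classical
  rintro ⟨f, hf, hfe⟩
  change Set.InjOn f ((Finset.range k ∪ Finset.Ico k n : Finset ℕ) : Set ℕ) at hf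
  have hbody : Set.InjOn f (Finset.range k : Set ℕ) :=
    hf.mono (by exact_mod_cast Finset.subset_union_left)
  obtain ⟨x, hx, y, hy, hxy, hnadj⟩ := hclique ((Finset.range k).image f)
    (by rw [Finset.card_image_of_injOn hbody, Finset.card_range])
  obtain ⟨i, hi, rfl⟩ := Finset.mem_image.1 hx
  obtain ⟨j, hj, rfl⟩ := Finset.mem_image.1 hy
  obtain ⟨T, hT, hTc, hTab⟩ := hspikes i (Finset.mem_range.1 hi) j (Finset.mem_range.1 hj)
    (fun h => hxy (by rw [h]))
  have hTinj : Set.InjOn f (T : Set ℕ) :=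
    hf.mono (by exact_mod_cast hT.trans Finset.subset_union_right)
  have hadj : ∀ v ∈ T, F.Adj (f i) (f v) ∨ F.Adj (f j) (f v) := by
    intro v hv
    obtain ⟨rfl, rfl⟩ := hTab v hv
    obtain ⟨p, hp, r, hr, hpr⟩ := hc _ (hfe _ (Finset.mem_image_of_mem _ (hT hv)))
    simp only [Finset.image_insert, Finset.image_singleton, Finset.mem_insert,
      Finset.mem_singleton] at hp hr
    rcases hp with rfl | rfl | rfl <;> rcases hr with rfl | rfl | rfl <;>
      simp_all [F.adj_comm]
  have h1 := hdeg (f i) ((T.image f).filter fun w => F.Adj (f i) w) (by simp)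
  have h2 := hdeg (f j) ((T.image f).filter fun w => F.Adj (f j) w) (by simp)
  have h3 : (T.image f).card = 2 * D := by rw [Finset.card_image_of_injOn hTinj, hTc]
  have h4 : T.image f ⊆ (T.image f).filter (fun w => F.Adj (f i) w) ∪
      (T.image f).filter (fun w => F.Adj (f j) w) := by
    intro w hw
    obtain ⟨v, hv, rfl⟩ := Finset.mem_image.1 hw
    rw [Finset.mem_union, Finset.mem_filter, Finset.mem_filter]
    exact (hadj v hv).imp (⟨hw, ·⟩) (⟨hw, ·⟩)
  have h5 := (Finset.card_le_card h4).trans (Finset.card_union_le _ _)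
  omega

theorem exists_hedgehog_forall_pair_spikes (k n K : ℕ) (hk : 2 ≤ k) (hn : k ^ 2 * (K + 1) ≤ n) :
    ∃ a b : ℕ → ℕ, (∀ v, a v < k) ∧ (∀ v, b v < k) ∧ (∀ v, a v ≠ b v) ∧
      ∀ i < k, ∀ j < k, i ≠ j → ∃ T ⊆ Finset.Ico k n, T.card = K ∧
        ∀ v ∈ T, a v = i ∧ b v = j := by
  have hk0 : 0 < k := by omega
  refine ⟨fun v => if v % k = v / k % k then 0 else v % k,
    fun v => if v % k = v / k % k then 1 else v / k % k, fun v => ?_, fun v => ?_, fun v => ?_, ?_⟩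
  · have := Nat.mod_lt v hk0
    dsimp only; split_ifs <;> omega
  · have := Nat.mod_lt (v / k) hk0
    dsimp only; split_ifs <;> omega
  · dsimp only; split_ifs <;> omega
  · intro i hi j hj hij
    refine ⟨(Finset.range K).image fun m => i + k * (j + k * (m + 1)), ?_, ?_, ?_⟩
    · intro v hv
      obtain ⟨m, hm, rfl⟩ := Finset.mem_image.1 hv
      rw [Finset.mem_range] at hm
      rw [Finset.mem_Ico]
      constructor
      · nlinarith [Nat.zero_le (k * j), Nat.zero_le (k * k * m)]
      · have h1 : k * (j + k * (m + 1) + 1) ≤ k * (k * (K + 1)) := by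
          refine Nat.mul_le_mul_left _ ?_
          calc j + k * (m + 1) + 1 ≤ k * (m + 1) + k := by omega
            _ = k * (m + 1 + 1) := by ring
            _ ≤ k * (K + 1) := Nat.mul_le_mul_left _ (by omega)
        nlinarith
    · rw [Finset.card_image_of_injective, Finset.card_range]
      intro m m' h
      have h1 := Nat.eq_of_mul_eq_mul_left hk0 (Nat.add_left_cancel h)
      have h2 := Nat.eq_of_mul_eq_mul_left hk0 (Nat.add_left_cancel h1)
      omega
    · intro v hv
      obtain ⟨m, hm, rfl⟩ := Finset.mem_image.1 hv
      have h1 : (i + k * (j + k * (m + 1))) % k = i := by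
        rw [Nat.add_mul_mod_self_left, Nat.mod_eq_of_lt hi]
      have h2 : (i + k * (j + k * (m + 1))) / k % k = j := by
        rw [Nat.add_mul_div_left _ _ hk0, Nat.div_eq_of_lt hi, zero_add,
          Nat.add_mul_mod_self_left, Nat.mod_eq_of_lt hj]
      simp only [h1, h2, hij, if_false, and_self]

/-- No copy of a standard hedgehog with body of size at least `s` avoids all triples spanning an
edge of `F`, for a graph `F` without independent sets of size `s`. -/
theorem ThreeGraph.IsStandardHedgehogWith.not_hasCopy {β V : Type*} [DecidableEq β] [DecidableEq V]
    {G : ThreeGraph β} {B S : Finset β} (hG : G.IsStandardHedgehogWith B S) {s : ℕ}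
    (hs : s ≤ B.card) (F : SimpleGraph V) (c : Finset V → Bool)
    (hc : ∀ e, c e = true → ∀ x ∈ e, ∀ y ∈ e, ¬ F.Adj x y)
    (hindep : ∀ I : Finset V, I.card = s → ∃ x ∈ I, ∃ y ∈ I, F.Adj x y) :
    ¬ G.HasCopy c true := by
  rintro ⟨f, hf, hfe⟩
  obtain ⟨U, hU, hUc⟩ := Finset.exists_subset_card_eq hs
  have hUinj : Set.InjOn f (U : Set β) := hf.mono (by
    rw [hG.1.2.1]
    exact_mod_cast hU.trans Finset.subset_union_left)
  obtain ⟨x, hx, y, hy, hxy⟩ := hindep (U.image f)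
    (by rw [Finset.card_image_of_injOn hUinj, hUc])
  obtain ⟨u, hu, rfl⟩ := Finset.mem_image.1 hx
  obtain ⟨v, hv, rfl⟩ := Finset.mem_image.1 hy
  have huv : u ≠ v := fun h => F.ne_of_adj hxy (by rw [h])
  obtain ⟨e, he⟩ := Finset.card_eq_one.1 (hG.2 u (hU hu) v (hU hv) huv)
  have hmem : e ∈ G.edges.filter (fun e => u ∈ e ∧ v ∈ e) := by rw [he]; simp
  rw [Finset.mem_filter] at hmem
  exact hc _ (hfe e hmem.1) _ (Finset.mem_image_of_mem f hmem.2.1) _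
    (Finset.mem_image_of_mem f hmem.2.2) hxy

theorem sqrt_le_findGreatest {n : ℕ} (hn : 1 ≤ n) :
    Nat.sqrt n ≤ Nat.findGreatest (fun t => t + t.choose 2 ≤ n) n := by
  refine Nat.le_findGreatest (Nat.sqrt_le_self n) ?_
  have h0 : 0 < Nat.sqrt n := Nat.sqrt_pos.2 hn
  have h1 : Nat.sqrt n * Nat.sqrt n ≤ n := Nat.sqrt_le n
  have h2 : (Nat.sqrt n).choose 2 ≤ Nat.sqrt n * (Nat.sqrt n - 1) := by
    rw [Nat.choose_two_right]; exact Nat.div_le_self _ _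
  have h3 : Nat.sqrt n + Nat.sqrt n * (Nat.sqrt n - 1) = Nat.sqrt n * Nat.sqrt n := by
    rw [Nat.mul_sub_one]
    have := Nat.le_mul_self (Nat.sqrt n)
    omega
  omega

theorem rpow_div_log_le_of_sqrt {n : ℕ} (hL : 1 ≤ Real.log (Nat.sqrt n))
    (hs : (1000000 : ℝ) ≤ Nat.sqrt n) :
    1 / 200000 * (n : ℝ) ^ (3 / 2 : ℝ) / Real.log n ≤
      (Nat.sqrt n : ℝ) ^ 3 / (50000 * Real.log (Nat.sqrt n)) := by
  have h1 : (n : ℝ) ≤ (2 * Nat.sqrt n) ^ 2 := by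
    have : (n : ℝ) < (Nat.sqrt n + 1) * (Nat.sqrt n + 1) := by
      exact_mod_cast Nat.lt_succ_sqrt n
    nlinarith
  have h2 : (Nat.sqrt n : ℝ) ^ 2 ≤ n := by exact_mod_cast Nat.sqrt_le' n
  have h3 : (n : ℝ) ^ (3 / 2 : ℝ) ≤ 8 * (Nat.sqrt n : ℝ) ^ 3 := by
    calc (n : ℝ) ^ (3 / 2 : ℝ) ≤ ((2 * Nat.sqrt n : ℝ) ^ 2) ^ (3 / 2 : ℝ) := by gcongr
      _ = (2 * Nat.sqrt n : ℝ) ^ (3 : ℕ) := by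
          rw [← Real.rpow_natCast, ← Real.rpow_natCast, ← Real.rpow_mul (by positivity)]
          norm_num
      _ = _ := by ring
  have h4 : 2 * Real.log (Nat.sqrt n) ≤ Real.log n := by
    have h := Real.log_le_log (by positivity) h2
    rw [Real.log_pow] at h
    exact_mod_cast h
  calc _ ≤ 1 / 200000 * (8 * (Nat.sqrt n : ℝ) ^ 3) / (2 * Real.log (Nat.sqrt n)) := by gcongr
    _ = _ := by field_simp; norm_num

/-- There is a constant `c > 0` such that for all sufficiently large `n` there is an
`n`-vertex generalised hedgehog `H*` with `R(S_n, H*) ≥ c · n^{3/2} / log n`, where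
`S_n` is the standard hedgehog whose body has `t` vertices (and hence `t.choose 2`
spikes), `t` being the largest integer with `t + t.choose 2 ≤ n`. -/
theorem standard_vs_genhedgehog_ramsey_lower_bound :
    ∃ c : ℝ, 0 < c ∧ ∃ n₀ : ℕ, ∀ n : ℕ, n₀ ≤ n →
      ∃ H : ThreeGraph ℕ, H.IsGenHedgehog ∧ H.verts.card = n ∧
        ∀ (β : Type) [DecidableEq β] (Sn : ThreeGraph β) (B S : Finset β),
          Sn.IsStandardHedgehogWith B S →
          B.card = Nat.findGreatest (fun t => t + t.choose 2 ≤ n) n →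
          ∀ N : ℕ, RamseyProp Sn H N →
            c * (n : ℝ) ^ (3/2 : ℝ) / Real.log n ≤ (N : ℝ) := by
  obtain ⟨s₀, hs₀⟩ := Filter.eventually_atTop.1 eventually_growth
  refine ⟨1 / 200000, by norm_num, s₀ ^ 2, fun n hn => ?_⟩
  obtain ⟨hL, hLs, hs, hpow⟩ := hs₀ (Nat.sqrt n) (Nat.le_sqrt'.2 hn)
  set s := Nat.sqrt n
  have hsn : s ^ 2 ≤ n := Nat.sqrt_le' n
  have hsN : 1000000 ≤ s := by exact_mod_cast hs
  have hs2 : 1000000 ≤ s ^ 2 := hsN.trans (Nat.le_self_pow two_ne_zero s)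
  set D := s ^ 2 / 400
  obtain ⟨a, b, ha, hb, hab, hspikes⟩ :=
    exists_hedgehog_forall_pair_spikes 13 n (2 * D) (by norm_num) (by omega)
  refine ⟨hedgehogOfPairs 13 n a b ha hb hab, hedgehogOfPairs_isGenHedgehog 13 n a b ha hb hab,
    ?_, ?_⟩
  · change (Finset.range 13 ∪ Finset.Ico 13 n).card = n
    have : Finset.range 13 ∪ Finset.Ico 13 n = Finset.range n := by
      ext x
      simp only [Finset.mem_union, Finset.mem_range, Finset.mem_Ico]
      omega
    rw [this, Finset.card_range]
  · intro β _ Sn B S hSn hB N hN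
    by_contra! hlt
    obtain ⟨q, hq, hsum⟩ := union_bound_lt_one hL hLs hs hpow
      (hlt.le.trans (rpow_div_log_le_of_sqrt hL hs))
    obtain ⟨F, hindep, hclique, hdeg⟩ := exists_graph_of_union_bound N q s 13 D hq hsum
    classical
    rcases hN fun e => decide (∀ x ∈ e, ∀ y ∈ e, ¬ F.Adj x y) with hblue | hred
    · exact hSn.not_hasCopy (hB ▸ sqrt_le_findGreatest (by omega)) F _
        (fun e he => of_decide_eq_true he) hindep hblue
    · refine hedgehogOfPairs_not_hasCopy 13 n D a b ha hb hab hspikes F _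
        (fun e he => ?_) hclique hdeg hred
      have := of_decide_eq_false he
      push Not at this
      exact this
end

section
/- For all sufficiently large n, there exists a simple graph G on ⌊n^{3/2} / (10^6 · log n)⌋ vertices such that: (i) every vertex of G has degree at most 3n/2000; (ii) G contains no clique on 10 vertices; and (iii) G has no independent set of ⌈√n / 50⌉ vertices. -/
open Finset in
/-- The expectation of a product of edge-wise factors over a random set that contains
each element of `E` independently with probability `p`. -/
theorem sum_bernoulli_weight_mul_prod {E : Type*} [Fintype E] [DecidableEq E] (p : ℝ)
    (a b : E → ℝ) :
    ∑ S : Finset E, ((∏ _e ∈ S, p) * ∏ _e ∈ univ \ S, (1 - p)) *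
        ((∏ e ∈ S, a e) * ∏ e ∈ univ \ S, b e) =
      ∏ e, (p * a e + (1 - p) * b e) := by
  rw [Finset.prod_add, Finset.powerset_univ]
  refine Finset.sum_congr rfl fun S _ => ?_
  rw [Finset.prod_mul_distrib, Finset.prod_mul_distrib]
  ring

open Finset in
theorem sum_bernoulli_weight {E : Type*} [Fintype E] [DecidableEq E] (p : ℝ) :
    ∑ S : Finset E, ((∏ _e ∈ S, p) * ∏ _e ∈ univ \ S, (1 - p)) = 1 := by
  simpa using sum_bernoulli_weight_mul_prod (E := E) p (fun _ => 1) (fun _ => 1)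

open Finset in
theorem sum_bernoulli_weight_subset {E : Type*} [Fintype E] [DecidableEq E] (p : ℝ)
    (A : Finset E) :
    ∑ S : Finset E, ((∏ _e ∈ S, p) * ∏ _e ∈ univ \ S, (1 - p)) *
        (if A ⊆ S then 1 else 0) = p ^ A.card := by
  have h := sum_bernoulli_weight_mul_prod (E := E) p (fun _ => 1)
    (fun e => if e ∈ A then 0 else 1)
  have hr : ∏ e, (p * 1 + (1 - p) * (if e ∈ A then (0 : ℝ) else 1)) = p ^ A.card := by
    rw [← Finset.prod_const, ← Finset.prod_subset (Finset.subset_univ A)]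
    · refine Finset.prod_congr rfl fun e he => ?_
      simp [he]
    · intro e _ he
      simp [he]
  rw [← hr, ← h]
  refine Finset.sum_congr rfl fun S _ => ?_
  congr 1
  split_ifs with hA
  · rw [Finset.prod_const_one, one_mul, Finset.prod_eq_one]
    intro e he
    have : e ∉ A := fun h => (Finset.mem_sdiff.1 he).2 (hA h)
    simp [this]
  · obtain ⟨e, heA, heS⟩ := Finset.not_subset.1 hA
    rw [Finset.prod_eq_zero (s := univ \ S) (i := e) (by simp [heS]) (by simp [heA]), mul_zero]

open Finset in
theorem sum_bernoulli_weight_disjoint {E : Type*} [Fintype E] [DecidableEq E] (p : ℝ)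
    (A : Finset E) :
    ∑ S : Finset E, ((∏ _e ∈ S, p) * ∏ _e ∈ univ \ S, (1 - p)) *
        (if Disjoint A S then 1 else 0) = (1 - p) ^ A.card := by
  have h := sum_bernoulli_weight_mul_prod (E := E) p
    (fun e => if e ∈ A then 0 else 1) (fun _ => 1)
  have hr : ∏ e, (p * (if e ∈ A then (0 : ℝ) else 1) + (1 - p) * 1) = (1 - p) ^ A.card := by
    rw [← Finset.prod_const, ← Finset.prod_subset (Finset.subset_univ A)]
    · refine Finset.prod_congr rfl fun e he => ?_
      simp [he]
    · intro e _ he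
      simp [he]
  rw [← hr, ← h]
  refine Finset.sum_congr rfl fun S _ => ?_
  congr 1
  split_ifs with hA
  · rw [Finset.prod_const_one, mul_one, Finset.prod_eq_one]
    intro e he
    have : e ∉ A := fun h => Finset.disjoint_left.1 hA h he
    simp [this]
  · obtain ⟨e, heA, heS⟩ := Finset.not_disjoint_iff.1 hA
    rw [Finset.prod_eq_zero (i := e) heS (by simp [heA]), zero_mul]

open Finset in
theorem sum_bernoulli_weight_two_pow {E : Type*} [Fintype E] [DecidableEq E] (p : ℝ)
    (A : Finset E) :
    ∑ S : Finset E, ((∏ _e ∈ S, p) * ∏ _e ∈ univ \ S, (1 - p)) *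
        2 ^ (A ∩ S).card = (1 + p) ^ A.card := by
  have h := sum_bernoulli_weight_mul_prod (E := E) p
    (fun e => if e ∈ A then 2 else 1) (fun _ => 1)
  have hr : ∏ e, (p * (if e ∈ A then (2 : ℝ) else 1) + (1 - p) * 1) = (1 + p) ^ A.card := by
    rw [← Finset.prod_const, ← Finset.prod_subset (Finset.subset_univ A)]
    · refine Finset.prod_congr rfl fun e he => ?_
      simp only [he, if_true]
      ring
    · intro e _ he
      simp [he]
  rw [← hr, ← h]
  refine Finset.sum_congr rfl fun S _ => ?_
  congr 1
  rw [Finset.prod_const_one, mul_one, Finset.prod_ite, Finset.prod_const, Finset.prod_const_one,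
    mul_one, Finset.filter_mem_eq_inter, Finset.inter_comm]

open Finset in
/-- First-moment existence criterion for a graph with small degrees, small clique number and
small independence number. -/
theorem exists_graph_of_expectation_lt_one_s3 (N r k T : ℕ) (p : ℝ) (hp0 : 0 ≤ p) (hp1 : p ≤ 1)
    (h : (N : ℝ) ^ r * p ^ (r.choose 2) + (N : ℝ) ^ k * (1 - p) ^ (k.choose 2)
      + N * ((1 + p) ^ N / 2 ^ T) < 1) :
    ∃ G : SimpleGraph (Fin N), (∀ v, {w | G.Adj v w}.ncard < T) ∧ G.CliqueFree r ∧
      ∀ s : Finset (Fin N), (∀ u ∈ s, ∀ v ∈ s, u ≠ v → ¬ G.Adj u v) → s.card < k := by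
  classical
  let W : Finset (Sym2 (Fin N)) → ℝ := fun S => (∏ _e ∈ S, p) * ∏ _e ∈ univ \ S, (1 - p)
  let K : Finset (Fin N) → Finset (Sym2 (Fin N)) := fun s => s.offDiag.image fun x => s(x.1, x.2)
  let I : Fin N → Finset (Sym2 (Fin N)) := fun v => univ.image fun w => s(v, w)
  let F : Finset (Sym2 (Fin N)) → ℝ := fun S =>
    ∑ s ∈ powersetCard r univ, (if K s ⊆ S then (1 : ℝ) else 0)
    + ∑ s ∈ powersetCard k univ, (if Disjoint (K s) S then (1 : ℝ) else 0)
    + ∑ v, (2 : ℝ) ^ (I v ∩ S).card / 2 ^ T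
  have hW : ∀ S, 0 ≤ W S := fun S =>
    mul_nonneg (prod_nonneg fun _ _ => hp0) (prod_nonneg fun _ _ => by linarith)
  have hcardK : ∀ s, (K s).card = s.card.choose 2 := fun s => Sym2.card_image_offDiag s
  have hEF : ∑ S, W S * F S < 1 := by
    refine lt_of_le_of_lt ?_ h
    have e : ∑ S, W S * F S = ∑ s ∈ powersetCard r univ, ∑ S, W S * (if K s ⊆ S then (1 : ℝ) else 0)
        + ∑ s ∈ powersetCard k univ, ∑ S, W S * (if Disjoint (K s) S then (1 : ℝ) else 0)
        + ∑ v, (∑ S, W S * (2 : ℝ) ^ (I v ∩ S).card) / 2 ^ T := by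
      simp only [F, mul_add, sum_add_distrib, mul_sum, sum_div, mul_div_assoc]
      congr 1
      · congr 1 <;> exact sum_comm
      · exact sum_comm
    rw [e]
    have hchoose : ∀ j, ((N.choose j : ℕ) : ℝ) ≤ (N : ℝ) ^ j := fun j => by
      exact_mod_cast Nat.choose_le_pow N j
    gcongr ?_ + ?_ + ?_
    · rw [sum_congr rfl (g := fun _ => p ^ (r.choose 2))]
      · rw [sum_const, card_powersetCard, card_univ, Fintype.card_fin, nsmul_eq_mul]
        gcongr
        exact hchoose r
      · intro s hs
        rw [← (mem_powersetCard.1 hs).2, ← hcardK]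
        exact sum_bernoulli_weight_subset p (K s)
    · rw [sum_congr rfl (g := fun _ => (1 - p) ^ (k.choose 2))]
      · rw [sum_const, card_powersetCard, card_univ, Fintype.card_fin, nsmul_eq_mul]
        exact mul_le_mul_of_nonneg_right (hchoose k) (pow_nonneg (by linarith) _)
      · intro s hs
        rw [← (mem_powersetCard.1 hs).2, ← hcardK]
        exact sum_bernoulli_weight_disjoint p (K s)
    · refine (sum_le_card_nsmul univ _ ((1 + p) ^ N / 2 ^ T) fun v _ => ?_).trans ?_
      · gcongr
        refine (sum_bernoulli_weight_two_pow p (I v)).le.trans ?_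
        refine pow_le_pow_right₀ (by linarith) ?_
        exact card_image_le.trans (by simp)
      · simp
  obtain ⟨S, hS⟩ : ∃ S, F S < 1 := by
    by_contra! hF
    have : ∑ S, W S ≤ ∑ S, W S * F S :=
      sum_le_sum fun S _ => le_mul_of_one_le_right (hW S) (hF S)
    have h1 : ∑ S, W S = 1 := sum_bernoulli_weight p
    linarith
  have n1 : 0 ≤ ∑ s ∈ powersetCard r univ, (if K s ⊆ S then (1 : ℝ) else 0) :=
    sum_nonneg fun _ _ => by positivity
  have n2 : 0 ≤ ∑ s ∈ powersetCard k univ, (if Disjoint (K s) S then (1 : ℝ) else 0) :=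
    sum_nonneg fun _ _ => by positivity
  have n3 : 0 ≤ ∑ v, (2 : ℝ) ^ (I v ∩ S).card / 2 ^ T :=
    sum_nonneg fun _ _ => by positivity
  refine ⟨SimpleGraph.fromEdgeSet (S : Set (Sym2 (Fin N))), fun v => ?_, fun s hs => ?_,
    fun s hs => ?_⟩
  · have h3 : (2 : ℝ) ^ (I v ∩ S).card / 2 ^ T < 1 :=
      (single_le_sum (f := fun v => (2 : ℝ) ^ (I v ∩ S).card / 2 ^ T)
        (fun _ _ => by positivity) (mem_univ v)).trans_lt (by simp only [F] at hS; linarith)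
    rw [div_lt_one (by positivity)] at h3
    refine lt_of_le_of_lt ?_ ((pow_lt_pow_iff_right₀ (by norm_num : (1 : ℝ) < 2)).1 h3)
    rw [← Set.ncard_coe_finset]
    refine Set.ncard_le_ncard_of_injOn (fun w => s(v, w)) ?_ ?_ (Set.toFinite _)
    · intro w hw
      simp only [Set.mem_ofPred_eq, SimpleGraph.fromEdgeSet_adj, mem_coe] at hw
      simp [I, hw.1]
    · intro a _ b _ hab
      exact Sym2.congr_right.1 hab
  · have hmem : s ∈ powersetCard r (univ : Finset (Fin N)) :=
      mem_powersetCard.2 ⟨subset_univ _, hs.card_eq⟩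
    have h1 := single_le_sum (f := fun s => if K s ⊆ S then (1 : ℝ) else 0)
      (fun _ _ => by positivity) hmem
    have hK : K s ⊆ S := by
      intro e he
      obtain ⟨⟨a, b⟩, hab, rfl⟩ := mem_image.1 he
      rw [mem_offDiag] at hab
      exact ((SimpleGraph.fromEdgeSet_adj _).1
        (hs.isClique (mem_coe.2 hab.1) (mem_coe.2 hab.2.1) hab.2.2)).1
    simp only [hK, if_true] at h1
    simp only [F] at hS
    linarith
  · by_contra! hk
    obtain ⟨t, hts, ht⟩ := exists_subset_card_eq hk
    have hmem : t ∈ powersetCard k (univ : Finset (Fin N)) :=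
      mem_powersetCard.2 ⟨subset_univ _, ht⟩
    have h1 := single_le_sum (f := fun s => if Disjoint (K s) S then (1 : ℝ) else 0)
      (fun _ _ => by positivity) hmem
    have hK : Disjoint (K t) S := by
      rw [disjoint_left]
      intro e he heS
      obtain ⟨⟨a, b⟩, hab, rfl⟩ := mem_image.1 he
      rw [mem_offDiag] at hab
      exact hs a (hts hab.1) b (hts hab.2.1) hab.2.2
        ((SimpleGraph.fromEdgeSet_adj _).2 ⟨heS, hab.2.2⟩)
    simp only [hK, if_true] at h1
    simp only [F] at hS
    linarith

theorem exp_lt_third_of_le_neg_two {x : ℝ} (hx : x ≤ -2) : Real.exp x < 1 / 3 := by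
  have h2 : Real.exp x * Real.exp (-x) = 1 := by rw [← Real.exp_add]; simp
  have h3 : 3 ≤ Real.exp (-x) := by linarith [Real.add_one_le_exp (-x)]
  have h4 : (-x) + 1 < Real.exp (-x) := Real.add_one_lt_exp (by linarith)
  nlinarith [Real.exp_pos x]

open Filter in
/-- The growth conditions on `n` used to choose the parameters of the random graph. -/
theorem eventually_log_growth : ∀ᶠ n : ℕ in atTop,
    (10 : ℝ) ≤ Real.log n ∧ 300 ^ 5 * Real.log n ^ 5 ≤ n ∧ 15000 * Real.log n ≤ n ∧
      (10 ^ 6 : ℝ) ≤ n := by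
  have h (m : ℕ) (c : ℝ) (hc : 0 < c) : ∀ᶠ n : ℕ in atTop, c * Real.log n ^ m ≤ n := by
    have := ((Real.isLittleO_pow_log_id_atTop (n := m)).bound
      (inv_pos.2 hc)).filter_mono tendsto_natCast_atTop_atTop
    have h2 : ∀ᶠ n : ℕ in atTop, ‖Real.log n ^ m‖ ≤ c⁻¹ * ‖(n : ℝ)‖ := this
    filter_upwards [h2] with n hn
    rw [Real.norm_of_nonneg (Nat.cast_nonneg n), inv_mul_eq_div, le_div_iff₀' hc] at hn
    exact (mul_le_mul_of_nonneg_left (Real.le_norm_self _) hc.le).trans hn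
  have hlog : ∀ᶠ n : ℕ in atTop, (10 : ℝ) ≤ Real.log n :=
    (Real.tendsto_log_atTop.comp tendsto_natCast_atTop_atTop).eventually_ge_atTop 10
  have hn : ∀ᶠ n : ℕ in atTop, (10 ^ 6 : ℝ) ≤ n :=
    tendsto_natCast_atTop_atTop.eventually_ge_atTop _
  filter_upwards [hlog, h 5 (300 ^ 5) (by norm_num), h 1 15000 (by norm_num), hn]
    with n h1 h2 h3 h4
  exact ⟨h1, h2, by simpa using h3, h4⟩

/-- For all sufficiently large `n`, there is a simple graph `G` on
`⌊n^{3/2} / (10^6 · log n)⌋` vertices such that (i) every vertex has degree at most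
`3n/2000`, (ii) `G` has no clique on `10` vertices, and (iii) `G` has no independent
set of `⌈√n / 50⌉` vertices. -/
theorem random_graph_exists :
    ∃ n₀ : ℕ, ∀ n : ℕ, n₀ ≤ n →
      ∀ N : ℕ, N = ⌊(n : ℝ) ^ (3/2 : ℝ) / (10 ^ 6 * Real.log n)⌋₊ →
        ∃ G : SimpleGraph (Fin N),
          (∀ v : Fin N, ({w : Fin N | G.Adj v w}.ncard : ℝ) ≤ 3 * n / 2000) ∧
          G.CliqueFree 10 ∧
          (∀ s : Finset (Fin N),
            (∀ u ∈ s, ∀ v ∈ s, u ≠ v → ¬ G.Adj u v) →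
            s.card < ⌈Real.sqrt n / 50⌉₊) := by
  obtain ⟨n₀, hn₀⟩ := Filter.eventually_atTop.1 eventually_log_growth
  refine ⟨n₀, fun n hn N hN => ?_⟩
  obtain ⟨hL, hL5, hL1, hn6⟩ := hn₀ n hn
  set L := Real.log n with hLdef
  set s := Real.sqrt n with hs
  have hss : s ^ 2 = n := Real.sq_sqrt (Nat.cast_nonneg n)
  have hs3 : 1000 ≤ s := Real.le_sqrt_of_sq_le ((by norm_num : (1000 : ℝ) ^ 2 = 10 ^ 6).trans_le hn6)
  have hs0 : 0 < s := by linarith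
  have hL0 : 0 < L := by linarith
  have hn0 : (0 : ℝ) < n := by linarith
  have hpow : (n : ℝ) ^ (3 / 2 : ℝ) = s ^ 3 := by
    rw [hs, Real.sqrt_eq_rpow, ← Real.rpow_natCast, ← Real.rpow_mul hn0.le]
    norm_num
  have hNle : (N : ℝ) ≤ s ^ 3 / (10 ^ 6 * L) := by
    rw [hN, hpow]
    exact Nat.floor_le (by positivity)
  set p := 300 * L / s with hp
  have hp0 : 0 < p := by positivity
  have hps : p * s = 300 * L := by rw [hp]; field_simp
  have hp5 : p ^ 5 * s ^ 3 ≤ 1 := by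
    have e : p ^ 5 * s ^ 3 * s ^ 2 ≤ 1 * s ^ 2 := by
      calc p ^ 5 * s ^ 3 * s ^ 2 = (p * s) ^ 5 := by ring
        _ = 300 ^ 5 * L ^ 5 := by rw [hps]; ring
        _ ≤ 1 * s ^ 2 := by rw [one_mul, hss]; exact hL5
    exact le_of_mul_le_mul_right e (by positivity)
  have hp1 : p ≤ 1 := by
    by_contra! hlt
    have h1 : 1 < p ^ 5 := one_lt_pow₀ hlt (by norm_num)
    have h2 : 1 < s ^ 3 := one_lt_pow₀ (by linarith) (by norm_num)
    nlinarith
  have hNp : N * p ≤ 3 / 10 ^ 4 * n := by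
    calc N * p ≤ s ^ 3 / (10 ^ 6 * L) * p := by gcongr
      _ = 3 / 10 ^ 4 * s ^ 2 := by rw [hp]; field_simp; norm_num
      _ = _ := by rw [hss]
  have hNexp : (N : ℝ) ≤ Real.exp (3 / 2 * L) := by
    have : Real.exp (3 / 2 * L) = (n : ℝ) ^ (3 / 2 : ℝ) := by
      rw [Real.rpow_def_of_pos hn0, mul_comm]
    rw [this, hpow]
    exact hNle.trans (div_le_self (by positivity) (by nlinarith))
  set k := ⌈s / 50⌉₊ with hk
  set T := ⌊(3 * n / 2000 : ℝ)⌋₊ + 1 with hT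
  have hkle : s / 50 ≤ k := Nat.le_ceil _
  have hTle : (3 * n / 2000 : ℝ) ≤ T := by
    rw [hT]; push_cast; exact (Nat.lt_floor_add_one _).le
  have clique : (N : ℝ) ^ 10 * p ^ (Nat.choose 10 2) < 1 / 3 := by
    have c : Nat.choose 10 2 = 45 := by decide
    have h1 : (N : ℝ) * p ≤ s ^ 2 := by rw [hss]; linarith
    have h2 : (N : ℝ) ^ 10 * p ^ 45 * s ≤ 1 := by
      calc (N : ℝ) ^ 10 * p ^ 45 * s = (N * p) ^ 10 * (p ^ 35 * s) := by ring
        _ ≤ (s ^ 2) ^ 10 * (p ^ 35 * s) := by gcongr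
        _ = (p ^ 5 * s ^ 3) ^ 7 := by ring
        _ ≤ 1 := pow_le_one₀ (by positivity) hp5
    rw [c]
    have h3 : 0 ≤ (N : ℝ) ^ 10 * p ^ 45 := by positivity
    nlinarith
  have indep : (N : ℝ) ^ k * (1 - p) ^ (k.choose 2) < 1 / 3 := by
    calc (N : ℝ) ^ k * (1 - p) ^ (k.choose 2)
        ≤ Real.exp (3 / 2 * L) ^ k * Real.exp (-p) ^ (k.choose 2) := by
          refine mul_le_mul (pow_le_pow_left₀ (by positivity) hNexp _)
            (pow_le_pow_left₀ (by linarith) (Real.one_sub_le_exp_neg p) _)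
            (pow_nonneg (by linarith) _) (by positivity)
      _ = Real.exp (k * (3 / 2 * L) + (k.choose 2) * (-p)) := by
          rw [← Real.exp_nat_mul, ← Real.exp_nat_mul, Real.exp_add]
      _ < 1 / 3 := by
          apply exp_lt_third_of_le_neg_two
          rw [Nat.cast_choose_two]
          have h1 : 2 * L ≤ p * (k - 1) / 2 := by
            have : p * (s / 50 - 1) ≤ p * (k - 1) := by gcongr
            have h2 : p * (s / 50 - 1) = 6 * L - p := by linear_combination hps / 50
            linarith
          have h2 : (20 : ℝ) ≤ k := by linarith
          nlinarith
  have degree : N * ((1 + p) ^ N / 2 ^ T) < 1 / 3 := by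
    have hexp2 : (1 : ℝ) / 2 ^ T = Real.exp (-(T * Real.log 2)) := by
      rw [Real.exp_neg, Real.exp_nat_mul, Real.exp_log (by norm_num), one_div]
    calc N * ((1 + p) ^ N / 2 ^ T) = N * ((1 + p) ^ N * (1 / 2 ^ T)) := by ring
      _ ≤ Real.exp (3 / 2 * L) * (Real.exp p ^ N * Real.exp (-(T * Real.log 2))) := by
          rw [hexp2]
          gcongr
          linarith [Real.add_one_le_exp p]
      _ = Real.exp (3 / 2 * L + N * p - T * Real.log 2) := by
          rw [← Real.exp_nat_mul, ← Real.exp_add, ← Real.exp_add]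
          ring_nf
      _ < 1 / 3 := by
          apply exp_lt_third_of_le_neg_two
          have h2 : (3 * n / 2000 : ℝ) * (1 / 2) ≤ T * Real.log 2 := by
            have := Real.log_two_gt_d9
            gcongr
            linarith
          linarith
  obtain ⟨G, hdeg, hcl, hind⟩ := exists_graph_of_expectation_lt_one_s3 N 10 k T p hp0.le hp1
    (by linarith)
  refine ⟨G, fun v => ?_, hcl, hind⟩
  exact (Nat.cast_le.2 (Nat.lt_succ_iff.1 (hdeg v))).trans (Nat.floor_le (by positivity))
end

section
/- Let V be a finite set, let d_r and d_b be nonnegative integers with |V| ≥ d_r + d_b + 1, and let every 3-element subset of V be coloured red or blue. Fix u ∈ V, and call a pair {u, v} (for v ∈ V, v ≠ u) red if it is contained in fewer than d_r red triples and blue if it is contained in fewer than d_b blue triples. Then either u lies in at most 2·d_b red pairs, or u lies in at most 2·d_r blue pairs. -/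
/-- If finsets `R` and `B` are such that every `v ∈ R` is related to at most `a`
elements of `B`, and every `w ∈ B` is unrelated to at most `b` elements of `R`, then
`#R * #B ≤ #R * a + #B * b`. -/
theorem Finset.card_mul_card_le_of_bipartite {α β : Type*} (R : Finset α) (B : Finset β)
    (r : α → β → Prop) [∀ v w, Decidable (r v w)] (a b : ℕ)
    (hR : ∀ v ∈ R, (B.filter (fun w => r v w)).card ≤ a)
    (hB : ∀ w ∈ B, (R.filter (fun v => ¬ r v w)).card ≤ b) :
    R.card * B.card ≤ R.card * a + B.card * b := by
  have hsplit : R.card * B.card = ∑ v ∈ R, (B.filter (fun w => r v w)).card +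
      ∑ v ∈ R, (B.filter (fun w => ¬ r v w)).card := by
    rw [← Finset.sum_add_distrib]
    simp [Finset.card_filter_add_card_filter_not]
  have hswap : ∑ v ∈ R, (B.filter (fun w => ¬ r v w)).card =
      ∑ w ∈ B, (R.filter (fun v => ¬ r v w)).card :=
    Finset.sum_card_bipartiteAbove_eq_sum_card_bipartiteBelow (fun v w => ¬ r v w)
  rw [hsplit, hswap]
  exact Nat.add_le_add (by simpa using Finset.sum_le_card_nsmul R _ a hR)
    (by simpa using Finset.sum_le_card_nsmul B _ b hB)

/-- Let `V` be a finite set with `|V| ≥ d_r + d_b + 1` whose triples are each coloured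
red (`true`) or blue (`false`) by `c`.  Fix `u ∈ V` and call a pair `{u, v}` red if it
lies in fewer than `d_r` red triples, and blue if it lies in fewer than `d_b` blue
triples.  Then `u` is in at most `2·d_b` red pairs, or in at most `2·d_r` blue pairs. -/
theorem red_or_blue_pairs_bound {V : Type*} [Fintype V] [DecidableEq V]
    (dr db : ℕ) (hcard : dr + db + 1 ≤ Fintype.card V)
    (c : Finset V → Bool) (u : V) :
    (Finset.univ.filter (fun v : V => v ≠ u ∧
        (Finset.univ.filter
          (fun w : V => w ∉ ({u, v} : Finset V) ∧ c {u, v, w} = true)).card < dr)).card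
      ≤ 2 * db ∨
    (Finset.univ.filter (fun v : V => v ≠ u ∧
        (Finset.univ.filter
          (fun w : V => w ∉ ({u, v} : Finset V) ∧ c {u, v, w} = false)).card < db)).card
      ≤ 2 * dr := by
  by_contra! h
  obtain ⟨hR, hB⟩ := h
  set R := Finset.univ.filter (fun v : V => v ≠ u ∧
    (Finset.univ.filter
      (fun w : V => w ∉ ({u, v} : Finset V) ∧ c {u, v, w} = true)).card < dr) with hRdef
  set B := Finset.univ.filter (fun v : V => v ≠ u ∧
    (Finset.univ.filter
      (fun w : V => w ∉ ({u, v} : Finset V) ∧ c {u, v, w} = false)).card < db) with hBdef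
  have hdisj : ∀ v ∈ R, v ∉ B := by
    intro v hvR hvB
    simp only [hRdef, hBdef, Finset.mem_filter, Finset.mem_univ, true_and] at hvR hvB
    have hdeg : Fintype.card V ≤ ({u, v} : Finset V).card +
        ((Finset.univ.filter
          (fun w : V => w ∉ ({u, v} : Finset V) ∧ c {u, v, w} = true)).card +
        (Finset.univ.filter
          (fun w : V => w ∉ ({u, v} : Finset V) ∧ c {u, v, w} = false)).card) := by
      rw [← Finset.card_univ]
      refine le_trans (Finset.card_le_card fun w _ => ?_) (le_trans (Finset.card_union_le _ _)
        (Nat.add_le_add_left (Finset.card_union_le _ _) _))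
      by_cases hw : w ∈ ({u, v} : Finset V)
      · exact Finset.mem_union_left _ hw
      · refine Finset.mem_union_right _ ?_
        cases hc : c {u, v, w} <;> simp_all
    have hpair : ({u, v} : Finset V).card ≤ 2 := Finset.card_le_two
    omega
  have hne : ∀ v ∈ R, ∀ w ∈ B, v ≠ w := by
    rintro v hv w hw rfl
    exact hdisj v hv hw
  have key := Finset.card_mul_card_le_of_bipartite R B (fun v w => c {u, v, w} = true) dr db
    (by
      intro v hv
      refine le_trans (Finset.card_le_card fun w hw => ?_) (Finset.mem_filter.1 hv).2.2.le
      obtain ⟨hwB, hc⟩ := Finset.mem_filter.1 hw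
      have hwu := (Finset.mem_filter.1 hwB).2.1
      have hvw := hne v hv w hwB
      simp only [Finset.mem_filter, Finset.mem_univ, Finset.mem_insert, Finset.mem_singleton,
        true_and, not_or]
      exact ⟨⟨hwu, hvw.symm⟩, hc⟩)
    (by
      intro w hw
      refine le_trans (Finset.card_le_card fun v hv => ?_) (Finset.mem_filter.1 hw).2.2.le
      obtain ⟨hvR, hc⟩ := Finset.mem_filter.1 hv
      have hvu := (Finset.mem_filter.1 hvR).2.1
      have hvw := hne v hvR w hw
      simp only [Finset.mem_filter, Finset.mem_univ, Finset.mem_insert, Finset.mem_singleton,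
        true_and, not_or]
      refine ⟨⟨hvu, hvw⟩, ?_⟩
      rw [Finset.pair_comm w v]
      exact Bool.eq_false_iff.2 hc)
  nlinarith [Nat.mul_le_mul_left R.card hB, Nat.mul_le_mul_left B.card hR]
end
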